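/- arXiv:2604.17613 — 2 statements merged into one kernel-verified Lean document; each statement's English description precedes it below -/
import Mathlib

section
/- Fix an integer r ≥ 2. Call a finite set A of positive integers r-in-fork-free if there do not exist an element x ∈ A and r distinct elements y₁, ..., y_r ∈ A \ {x} with y_j ∣ x for all j. Let f*_r(n) be the maximum cardinality of an r-in-fork-free subset of {1, ..., n}. Then there exists a real constant c*_r such that for every ε > 0 there is a constant K_ε with |f*_r(n) − c*_r·n| ≤ K_ε · n · exp(−(1−ε)·√(log n · log log n)) for all n ≥ 3. -/
open Finset
open scoped Classical

/-- A finite set of positive integers is `r`-in-fork-free if no element is a multiple of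
`r` other distinct elements. -/
def RInForkFree (r : ℕ) (A : Finset ℕ) : Prop :=
  ¬∃ x ∈ A, ∃ Y : Finset ℕ, Y ⊆ A.erase x ∧ Y.card = r ∧ ∀ y ∈ Y, y ∣ x

/-- `f*_r(n)`: the maximum cardinality of an `r`-in-fork-free subset of `{1, …, n}`. -/
noncomputable def fInFork (r n : ℕ) : ℕ :=
  ((Finset.Icc 1 n).powerset.filter (RInForkFree r)).sup Finset.card

/-- The maximum cardinality of an `r`-in-fork-free subset of a finite set `S`. -/
noncomputable def maxFree (r : ℕ) (S : Finset ℕ) : ℕ :=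
  (S.powerset.filter (RInForkFree r)).sup Finset.card

theorem RInForkFree.mono {r : ℕ} {A B : Finset ℕ} (hB : RInForkFree r B) (h : A ⊆ B) :
    RInForkFree r A := by
  rintro ⟨x, hx, Y, hY, hc, hd⟩
  exact hB ⟨x, h hx, Y, hY.trans (erase_subset_erase x h), hc, hd⟩

theorem RInForkFree.card_le_maxFree {r : ℕ} {A S : Finset ℕ} (hA : RInForkFree r A) (h : A ⊆ S) :
    #A ≤ maxFree r S :=
  le_sup (f := Finset.card) (mem_filter.2 ⟨mem_powerset.2 h, hA⟩)

theorem maxFree_le {r : ℕ} {S : Finset ℕ} {m : ℕ}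
    (h : ∀ A ⊆ S, RInForkFree r A → #A ≤ m) : maxFree r S ≤ m :=
  Finset.sup_le fun A hA => h A (mem_powerset.1 (mem_filter.1 hA).1) (mem_filter.1 hA).2

theorem exists_card_eq_maxFree (r : ℕ) (S : Finset ℕ) :
    ∃ A ⊆ S, RInForkFree r A ∧ #A = maxFree r S := by
  have hne : (S.powerset.filter (RInForkFree r)).Nonempty :=
    ⟨∅, mem_filter.2 ⟨mem_powerset.2 (empty_subset S), by simp [RInForkFree]⟩⟩
  obtain ⟨A, hA, h⟩ := exists_mem_eq_sup _ hne Finset.card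
  exact ⟨A, mem_powerset.1 (mem_filter.1 hA).1, (mem_filter.1 hA).2, h.symm⟩

theorem maxFree_mono (r : ℕ) {S T : Finset ℕ} (h : S ⊆ T) : maxFree r S ≤ maxFree r T :=
  maxFree_le fun _ hA hf => hf.card_le_maxFree (hA.trans h)

theorem maxFree_le_add_card_sdiff (r : ℕ) (S T : Finset ℕ) :
    maxFree r T ≤ maxFree r S + #(T \ S) := by
  refine maxFree_le fun A hA hf => ?_
  rw [← card_inter_add_card_sdiff A S]
  exact add_le_add ((hf.mono inter_subset_left).card_le_maxFree inter_subset_right)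
    (card_le_card (sdiff_subset_sdiff hA le_rfl))

theorem rInForkFree_image_mul {r t : ℕ} (ht : 0 < t) (A : Finset ℕ) :
    RInForkFree r (A.image (t * ·)) ↔ RInForkFree r A := by
  have hinj : Function.Injective (t * ·) := fun a b h => Nat.eq_of_mul_eq_mul_left ht h
  rw [RInForkFree, RInForkFree, not_iff_not]
  constructor
  · rintro ⟨x, hx, Y, hY, hc, hd⟩
    obtain ⟨z, hz, rfl⟩ := mem_image.1 hx
    rw [← image_erase hinj] at hY
    obtain ⟨Z, hZ, rfl⟩ := subset_image_iff.1 hY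
    refine ⟨z, hz, Z, by exact_mod_cast hZ, by rwa [card_image_of_injective _ hinj] at hc,
      fun y hy => ?_⟩
    exact (Nat.mul_dvd_mul_iff_left ht).1 (hd _ (mem_image_of_mem _ hy))
  · rintro ⟨x, hx, Y, hY, hc, hd⟩
    refine ⟨t * x, mem_image_of_mem _ hx, Y.image (t * ·), ?_,
      by rwa [card_image_of_injective _ hinj], fun y hy => ?_⟩
    · rw [← image_erase hinj]
      exact image_subset_image hY
    · obtain ⟨z, hz, rfl⟩ := mem_image.1 hy
      exact Nat.mul_dvd_mul_left t (hd z hz)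

theorem maxFree_image_mul {r t : ℕ} (ht : 0 < t) (S : Finset ℕ) :
    maxFree r (S.image (t * ·)) = maxFree r S := by
  have hinj : Function.Injective (t * ·) := fun a b h => Nat.eq_of_mul_eq_mul_left ht h
  apply le_antisymm
  · refine maxFree_le fun A hA hf => ?_
    obtain ⟨B, hB, rfl⟩ := subset_image_iff.1 hA
    rw [card_image_of_injective _ hinj]
    exact ((rInForkFree_image_mul ht B).1 hf).card_le_maxFree (by exact_mod_cast hB)
  · refine maxFree_le fun A hA hf => ?_
    rw [← card_image_of_injective A hinj]
    exact ((rInForkFree_image_mul ht A).2 hf).card_le_maxFree (image_subset_image hA)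

/-- If divisibility inside `S` preserves the value of `g`, then `maxFree` is additive over the
fibres of `g`. -/
theorem maxFree_eq_sum_fiber (r : ℕ) {S T : Finset ℕ} (g : ℕ → ℕ)
    (hg : ∀ a ∈ S, ∀ b ∈ S, a ∣ b → g a = g b) (hT : ∀ a ∈ S, g a ∈ T) :
    maxFree r S = ∑ t ∈ T, maxFree r (S.filter (g · = t)) := by
  apply le_antisymm
  · refine maxFree_le fun A hA hf => ?_
    rw [card_eq_sum_card_fiberwise (f := g) (t := T) fun a ha => hT a (hA ha)]
    exact sum_le_sum fun t _ =>
      (hf.mono (filter_subset _ _)).card_le_maxFree (filter_subset_filter _ hA)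
  · choose B hBs hBf hBc using fun t => exists_card_eq_maxFree r (S.filter (g · = t))
    have hBg : ∀ t, ∀ b ∈ B t, b ∈ S ∧ g b = t := fun t b hb => mem_filter.1 (hBs t hb)
    have hcard : #(T.biUnion B) = ∑ t ∈ T, maxFree r (S.filter (g · = t)) := by
      rw [card_biUnion]
      · exact sum_congr rfl fun t _ => hBc t
      · intro t _ u _ htu
        refine disjoint_left.2 fun b hb hb' => htu ?_
        rw [← (hBg t b hb).2, (hBg u b hb').2]
    rw [← hcard]
    refine RInForkFree.card_le_maxFree ?_ (biUnion_subset.2 fun t _ b hb => (hBg t b hb).1)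
    rintro ⟨x, hx, Y, hY, hc, hd⟩
    obtain ⟨t, ht, hxt⟩ := mem_biUnion.1 hx
    refine hBf t ⟨x, hxt, Y, fun y hy => ?_, hc, hd⟩
    obtain ⟨hne, hy'⟩ := mem_erase.1 (hY hy)
    obtain ⟨u, hu, hyu⟩ := mem_biUnion.1 hy'
    have h1 := hg y (hBg u y hyu).1 x (hBg t x hxt).1 (hd y hy)
    rw [(hBg u y hyu).2, (hBg t x hxt).2] at h1
    exact mem_erase.2 ⟨hne, h1 ▸ hyu⟩

/-- `t` has no prime factor below `K`. -/
def IsRough (K t : ℕ) : Prop := ∀ p ∈ K.primesBelow, ¬p ∣ t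

/-- The largest divisor of `m` without prime factors below `K`. -/
noncomputable def roughPart (K m : ℕ) : ℕ := (m.primeFactorsList.filter (K ≤ ·)).prod

theorem roughPart_mul_of_smooth_of_rough {K s t : ℕ} (hs : s ∈ Nat.smoothNumbers K) (ht : t ≠ 0)
    (htr : IsRough K t) : roughPart K (t * s) = t := by
  have hs0 := hs.1
  have h := ((Nat.perm_primeFactorsList_mul ht hs0).filter (K ≤ ·)).prod_eq
  rw [roughPart, h, List.filter_append, List.prod_append, List.filter_eq_self.2,
    List.filter_eq_nil_iff.2, Nat.prod_primeFactorsList ht, List.prod_nil, mul_one]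
  · intro p hp
    simpa using hs.2 p hp
  · intro p hp
    have hp' := Nat.prime_of_mem_primeFactorsList hp
    by_contra hK
    exact htr p (Nat.mem_primesBelow.2 ⟨by simpa using hK, hp'⟩)
      (Nat.dvd_of_mem_primeFactorsList hp)

theorem exists_smooth_mul_rough (K : ℕ) {m : ℕ} (hm : m ≠ 0) :
    ∃ t s, t ≠ 0 ∧ IsRough K t ∧ s ∈ Nat.smoothNumbers K ∧ m = t * s := by
  refine ⟨roughPart K m, (m.primeFactorsList.filter (· < K)).prod, ?_, ?_,
    Nat.prod_mem_smoothNumbers m K, ?_⟩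
  · intro h
    have h0 := List.prod_eq_zero_iff.1 h
    exact (Nat.prime_of_mem_primeFactorsList (List.mem_of_mem_filter h0)).ne_zero rfl
  · intro p hp hd
    obtain ⟨hpK, hp⟩ := Nat.mem_primesBelow.1 hp
    obtain ⟨q, hq, hpq⟩ := (Prime.dvd_prod_iff hp.prime).1 hd
    rw [List.mem_filter] at hq
    rw [Nat.prime_dvd_prime_iff_eq hp (Nat.prime_of_mem_primeFactorsList hq.1)] at hpq
    have := hq.2
    simp only [decide_eq_true_eq] at this
    omega
  · have h := List.prod_map_filter_mul_prod_map_filter_not (fun p => K ≤ p) id m.primeFactorsList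
    simp only [List.map_id, not_le, Nat.prod_primeFactorsList hm] at h
    exact h.symm

/-- The largest size of an `r`-in-fork-free set of `m ≤ n` with `⌊n / m⌋ < κ`. -/
noncomputable def topFree (r κ n : ℕ) : ℕ := maxFree r ((Icc 1 n).filter (n / · < κ))

/-- The analogue of `topFree` restricted to `K`-smooth numbers. -/
noncomputable def smoothTopFree (r K κ b : ℕ) : ℕ :=
  maxFree r ((Icc 1 b).filter fun s => s ∈ Nat.smoothNumbers K ∧ b / s < κ)

theorem filter_roughPart_eq {K κ n t : ℕ} (ht : t ≠ 0) (htr : IsRough K t) :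
    ((Icc 1 n).filter (n / · < κ)).filter (roughPart K · = t) =
      ((Icc 1 (n / t)).filter fun s => s ∈ Nat.smoothNumbers K ∧ n / t / s < κ).image (t * ·) := by
  ext m
  simp only [mem_filter, mem_Icc, mem_image]
  constructor
  · rintro ⟨⟨⟨h1, h2⟩, h3⟩, h4⟩
    obtain ⟨u, s, hu, hur, hs, rfl⟩ := exists_smooth_mul_rough K (by omega : m ≠ 0)
    rw [roughPart_mul_of_smooth_of_rough hs hu hur] at h4
    subst h4
    refine ⟨s, ⟨⟨Nat.one_le_iff_ne_zero.2 hs.1, ?_⟩, hs, ?_⟩, rfl⟩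
    · rwa [Nat.le_div_iff_mul_le (Nat.pos_of_ne_zero hu), mul_comm]
    · rwa [Nat.div_div_eq_div_mul]
  · rintro ⟨s, ⟨⟨h1, h2⟩, hs, h3⟩, rfl⟩
    rw [Nat.le_div_iff_mul_le (Nat.pos_of_ne_zero ht), mul_comm] at h2
    rw [Nat.div_div_eq_div_mul] at h3
    refine ⟨⟨⟨?_, h2⟩, h3⟩, roughPart_mul_of_smooth_of_rough hs ht htr⟩
    exact Nat.mul_pos (Nat.pos_of_ne_zero ht) h1

theorem topFree_eq_sum (r : ℕ) {K κ : ℕ} (hκ : κ ≤ K) (n : ℕ) :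
    topFree r κ n = ∑ t ∈ (Icc 1 n).filter (IsRough K), smoothTopFree r K κ (n / t) := by
  rw [topFree, maxFree_eq_sum_fiber r (T := (Icc 1 n).filter (IsRough K)) (roughPart K)]
  · refine sum_congr rfl fun t ht => ?_
    obtain ⟨ht1, htr⟩ := mem_filter.1 ht
    have ht0 : t ≠ 0 := by have := (mem_Icc.1 ht1).1; omega
    rw [filter_roughPart_eq ht0 htr, maxFree_image_mul (Nat.pos_of_ne_zero ht0), smoothTopFree]
  · intro a ha b hb hab
    simp only [mem_filter, mem_Icc] at ha hb
    obtain ⟨q, rfl⟩ := hab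
    obtain ⟨t, s, ht, htr, hs, rfl⟩ := exists_smooth_mul_rough K (by omega : a ≠ 0)
    have hq0 : q ≠ 0 := by rintro rfl; simp at hb
    have hqK : q < K := by
      refine lt_of_le_of_lt ?_ (ha.2.trans_le hκ)
      rw [Nat.le_div_iff_mul_le ha.1.1, mul_comm]
      exact hb.1.2
    have hq := Nat.mem_smoothNumbers_of_lt (Nat.pos_of_ne_zero hq0) hqK
    rw [mul_assoc, roughPart_mul_of_smooth_of_rough hs ht htr,
      roughPart_mul_of_smooth_of_rough (Nat.mul_mem_smoothNumbers hs hq) ht htr]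
  · intro a ha
    simp only [mem_filter, mem_Icc] at ha ⊢
    obtain ⟨t, s, ht, htr, hs, rfl⟩ := exists_smooth_mul_rough K (by omega : a ≠ 0)
    rw [roughPart_mul_of_smooth_of_rough hs ht htr]
    refine ⟨⟨Nat.pos_of_ne_zero ht, le_trans ?_ ha.1.2⟩, htr⟩
    exact Nat.le_mul_of_pos_right _ (Nat.pos_of_ne_zero hs.1)

theorem smoothTopFree_mono (r K b : ℕ) {κ κ' : ℕ} (h : κ ≤ κ') :
    smoothTopFree r K κ b ≤ smoothTopFree r K κ' b :=
  maxFree_mono r fun s hs => by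
    simp only [mem_filter] at hs ⊢
    exact ⟨hs.1, hs.2.1, hs.2.2.trans_le h⟩

/-- The `K`-smooth `s ≤ b` with `κ ≤ ⌊b / s⌋ < K`. -/
noncomputable def smoothBand (K κ b : ℕ) : Finset ℕ :=
  (Icc 1 b).filter fun s => s ∈ Nat.smoothNumbers K ∧ κ ≤ b / s ∧ b / s < K

theorem smoothTopFree_le_add_card_smoothBand (r K κ b : ℕ) :
    smoothTopFree r K K b ≤ smoothTopFree r K κ b + #(smoothBand K κ b) := by
  refine (maxFree_le_add_card_sdiff r _ _).trans (Nat.add_le_add_left (card_le_card ?_) _)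
  intro s hs
  simp only [mem_sdiff, mem_filter, smoothBand] at hs ⊢
  refine ⟨hs.1.1, hs.1.2.1, ?_, hs.1.2.2⟩
  by_contra h
  exact hs.2 ⟨hs.1.1, hs.1.2.1, by omega⟩

/-- The contribution of the smooth band at `b`. -/
noncomputable def bandWeight (r K κ b : ℕ) : ℝ :=
  (smoothTopFree r K K b : ℝ) - smoothTopFree r K κ b

theorem bandWeight_nonneg (r b : ℕ) {K κ : ℕ} (h : κ ≤ K) : 0 ≤ bandWeight r K κ b :=
  sub_nonneg.2 (by exact_mod_cast smoothTopFree_mono r K b h)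

theorem bandWeight_le (r K κ b : ℕ) : bandWeight r K κ b ≤ #(smoothBand K κ b) := by
  rw [bandWeight, sub_le_iff_le_add']
  exact_mod_cast smoothTopFree_le_add_card_smoothBand r K κ b

/-- The number of `K`-rough `t ≤ n` with `⌊n / t⌋ = b`. -/
noncomputable def roughCount (K n b : ℕ) : ℕ :=
  #((Icc 1 n).filter fun t => IsRough K t ∧ n / t = b)

theorem topFree_sub_topFree_eq_sum (r n : ℕ) {K κ : ℕ} (hκ : κ ≤ K) :
    (topFree r K n : ℝ) - topFree r κ n =
      ∑ b ∈ Icc 1 n, bandWeight r K κ b * roughCount K n b := by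
  rw [topFree_eq_sum r le_rfl, topFree_eq_sum r hκ, Nat.cast_sum, Nat.cast_sum,
    ← sum_sub_distrib, ← sum_fiberwise_of_maps_to (g := fun t => n / t) (t := Icc 1 n)]
  · refine sum_congr rfl fun b _ => ?_
    rw [roughCount, ← filter_filter, mul_comm, ← nsmul_eq_mul, ← sum_const]
    refine sum_congr rfl fun t ht => ?_
    rw [← (mem_filter.1 ht).2, bandWeight]
  · intro t ht
    have ht := mem_Icc.1 (mem_filter.1 ht).1
    exact mem_Icc.2 ⟨(Nat.one_le_div_iff ht.1).2 ht.2, Nat.div_le_self n t⟩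

theorem topFree_one (r n : ℕ) : topFree r 1 n = 0 := by
  refine Nat.le_zero.1 (maxFree_le fun A hA _ => ?_)
  refine (card_le_card hA).trans (Nat.le_zero.2 (card_eq_zero.2 (filter_eq_empty_iff.2 ?_)))
  intro m hm
  rw [mem_Icc] at hm
  have := (Nat.one_le_div_iff hm.1).2 hm.2
  omega

theorem fInFork_le_topFree_add (r n : ℕ) {κ : ℕ} (hκ : 0 < κ) :
    fInFork r n ≤ topFree r κ n + n / κ := by
  refine (maxFree_le_add_card_sdiff r ((Icc 1 n).filter (n / · < κ)) _).trans
    (Nat.add_le_add_left ?_ _)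
  refine (card_le_card (t := Ioc 0 (n / κ)) fun m hm => ?_).trans (by simp)
  simp only [mem_sdiff, mem_filter, mem_Icc, not_and, not_lt] at hm
  have h := hm.2 hm.1
  rw [Nat.le_div_iff_mul_le hm.1.1] at h
  rw [mem_Ioc, Nat.le_div_iff_mul_le hκ, mul_comm]
  exact ⟨hm.1.1, h⟩

theorem topFree_le_fInFork (r n κ : ℕ) : topFree r κ n ≤ fInFork r n :=
  maxFree_mono r (filter_subset _ _)

/-- The elementary symmetric sum of degree `i` of the values of `x` on `P`. -/
noncomputable def symmSum (P : Finset ℕ) (x : ℕ → ℝ) (i : ℕ) : ℝ :=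
  ∑ S ∈ P.powersetCard i, ∏ p ∈ S, x p

theorem symmSum_zero (P : Finset ℕ) (x : ℕ → ℝ) : symmSum P x 0 = 1 := by simp [symmSum]

theorem symmSum_insert_succ {P : Finset ℕ} {p : ℕ} (hp : p ∉ P) (x : ℕ → ℝ) (i : ℕ) :
    symmSum (insert p P) x (i + 1) = symmSum P x (i + 1) + x p * symmSum P x i := by
  have hnot : ∀ S ∈ P.powersetCard i, p ∉ S := fun S hS h => hp ((mem_powersetCard.1 hS).1 h)
  rw [symmSum, powersetCard_succ_insert hp, sum_union, sum_image, symmSum, symmSum, mul_sum]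
  · congr 1
    exact sum_congr rfl fun S hS => prod_insert (hnot S hS)
  · intro S hS T hT h
    rw [← erase_insert (hnot S hS), ← erase_insert (hnot T hT), h]
  · refine disjoint_left.2 fun S hS hS' => ?_
    obtain ⟨T, _, rfl⟩ := mem_image.1 hS'
    exact hp ((mem_powersetCard.1 hS).1 (mem_insert_self p T))

/-- The Bonferroni inequalities for a product of factors `1 - x p` with `0 ≤ x p ≤ 1`. -/
theorem abs_prod_one_sub_sub_sum_le (P : Finset ℕ) (x : ℕ → ℝ) (h0 : ∀ p ∈ P, 0 ≤ x p)
    (h1 : ∀ p ∈ P, x p ≤ 1) (w : ℕ) :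
    |∏ p ∈ P, (1 - x p) - ∑ i ∈ range w, (-1) ^ i * symmSum P x i| ≤ symmSum P x w := by
  induction P using Finset.induction_on generalizing w with
  | empty =>
    cases w with
    | zero => simp [symmSum_zero]
    | succ w =>
      have h : ∀ i, symmSum ∅ x (i + 1) = 0 := fun i => by
        rw [symmSum, powersetCard_eq_empty.2 (by simp), sum_empty]
      simp [sum_range_succ', symmSum_zero, h]
  | insert p P hp ih =>
    have h0' : ∀ q ∈ P, 0 ≤ x q := fun q hq => h0 q (mem_insert_of_mem hq)
    have h1' : ∀ q ∈ P, x q ≤ 1 := fun q hq => h1 q (mem_insert_of_mem hq)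
    have hp0 := h0 p (mem_insert_self p P)
    have hp1 := h1 p (mem_insert_self p P)
    cases w with
    | zero =>
      rw [range_zero, sum_empty, sub_zero, symmSum_zero, abs_le]
      have hn : 0 ≤ ∏ q ∈ insert p P, (1 - x q) :=
        prod_nonneg fun q hq => sub_nonneg.2 (h1 q hq)
      refine ⟨by linarith, prod_le_one (fun q hq => sub_nonneg.2 (h1 q hq)) fun q hq => ?_⟩
      linarith [h0 q hq]
    | succ w =>
      have hs : ∑ i ∈ range (w + 1), (-1) ^ i * symmSum (insert p P) x i =
          ∑ i ∈ range (w + 1), (-1) ^ i * symmSum P x i -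
            x p * ∑ i ∈ range w, (-1) ^ i * symmSum P x i := by
        rw [sum_range_succ', sum_range_succ' (fun i => (-1) ^ i * symmSum P x i), mul_sum,
          symmSum_zero, symmSum_zero, add_sub_right_comm, ← sum_sub_distrib]
        congr 1
        refine sum_congr rfl fun i _ => ?_
        rw [symmSum_insert_succ hp]
        ring
      rw [hs, prod_insert hp, symmSum_insert_succ hp]
      have e : (1 - x p) * ∏ q ∈ P, (1 - x q) -
          (∑ i ∈ range (w + 1), (-1) ^ i * symmSum P x i -
            x p * ∑ i ∈ range w, (-1) ^ i * symmSum P x i) =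
          (∏ q ∈ P, (1 - x q) - ∑ i ∈ range (w + 1), (-1) ^ i * symmSum P x i) -
            x p * (∏ q ∈ P, (1 - x q) - ∑ i ∈ range w, (-1) ^ i * symmSum P x i) := by ring
      rw [e]
      refine (abs_sub _ _).trans (add_le_add (ih h0' h1' _) ?_)
      rw [abs_mul, abs_of_nonneg hp0]
      exact mul_le_mul_of_nonneg_left (ih h0' h1' _) hp0

theorem pow_mul_symmSum_le (P : Finset ℕ) (x : ℕ → ℝ) (h0 : ∀ p ∈ P, 0 ≤ x p) {z : ℝ}
    (hz : 0 ≤ z) (w : ℕ) : z ^ w * symmSum P x w ≤ Real.exp (z * ∑ p ∈ P, x p) := by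
  calc z ^ w * symmSum P x w = ∑ S ∈ P.powersetCard w, ∏ p ∈ S, z * x p := by
        rw [symmSum, mul_sum]
        refine sum_congr rfl fun S hS => ?_
        rw [prod_mul_distrib, prod_const, (mem_powersetCard.1 hS).2]
    _ ≤ ∑ S ∈ P.powerset, ∏ p ∈ S, z * x p := by
        refine sum_le_sum_of_subset_of_nonneg (fun S hS => ?_) fun S hS _ => ?_
        · exact mem_powerset.2 (mem_powersetCard.1 hS).1
        · exact prod_nonneg fun p hp => mul_nonneg hz (h0 p (mem_powerset.1 hS hp))
    _ = ∏ p ∈ P, (1 + z * x p) := (prod_one_add P).symm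
    _ ≤ ∏ p ∈ P, Real.exp (z * x p) := by
        refine prod_le_prod (fun p hp => ?_) fun p _ => ?_
        · linarith [mul_nonneg hz (h0 p hp)]
        · linarith [Real.add_one_le_exp (z * x p)]
    _ = Real.exp (z * ∑ p ∈ P, x p) := by rw [← Real.exp_sum, mul_sum]

theorem sum_range_pow_le (m w : ℕ) : ∑ i ∈ range (w + 1), m ^ i ≤ (m + 1) ^ w := by
  induction w with
  | zero => simp
  | succ w ih =>
    rw [sum_range_succ', pow_succ]
    simp only [pow_succ, ← sum_mul, pow_zero]
    have : 1 ≤ (m + 1) ^ w := Nat.one_le_pow _ _ (by omega)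
    nlinarith

theorem sum_card_powersetCard_le {P : Finset ℕ} {K : ℕ} (hP : #P < K) (w : ℕ) :
    ∑ i ∈ range (w + 1), (#(P.powersetCard i) : ℝ) ≤ (K : ℝ) ^ w := by
  have h : ∑ i ∈ range (w + 1), #(P.powersetCard i) ≤ K ^ w := by
    refine (sum_le_sum fun i _ => ?_).trans ((sum_range_pow_le #P w).trans
      (Nat.pow_le_pow_left hP w))
    rw [card_powersetCard]
    exact Nat.choose_le_pow _ _
  exact_mod_cast h

theorem prod_ite_dvd_eq {S : Finset ℕ} (hS : ∀ p ∈ S, p.Prime) (t : ℕ) :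
    ∏ p ∈ S, (if p ∣ t then (1 : ℝ) else 0) = if ∏ p ∈ S, p ∣ t then 1 else 0 := by
  rw [prod_ite_zero]
  simp only [prod_const_one]
  congr 1
  refine propext ⟨fun h => prod_primes_dvd t (fun p hp => (hS p hp).prime) h, fun h p hp => ?_⟩
  exact (dvd_prod_of_mem _ hp).trans h

theorem abs_card_multiples_sub_le {n b d : ℕ} (hb : 0 < b) (hd : 0 < d) :
    |((#((Icc 1 n).filter fun t => d ∣ t ∧ n / t = b) : ℕ) : ℝ) - n / (b * (b + 1)) / d| ≤ 1 := by
  have hset : (Icc 1 n).filter (fun t => d ∣ t ∧ n / t = b) =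
      (Ioc 0 (n / b)).filter (d ∣ ·) \ (Ioc 0 (n / (b + 1))).filter (d ∣ ·) := by
    ext t
    simp only [mem_filter, mem_Icc, mem_sdiff, mem_Ioc]
    constructor
    · rintro ⟨⟨h1, h2⟩, h3, rfl⟩
      refine ⟨⟨⟨h1, ?_⟩, h3⟩, fun h => ?_⟩
      · rw [Nat.le_div_iff_mul_le hb, mul_comm]
        exact Nat.div_mul_le_self n t
      · have := h.1.2
        rw [Nat.le_div_iff_mul_le (by omega), mul_comm, ← Nat.le_div_iff_mul_le h1] at this
        omega
    · rintro ⟨⟨⟨h1, h2⟩, h3⟩, h4⟩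
      refine ⟨⟨h1, h2.trans (Nat.div_le_self _ _)⟩, h3, ?_⟩
      have h5 : ¬ t ≤ n / (b + 1) := fun h => h4 ⟨⟨h1, h⟩, h3⟩
      rw [Nat.le_div_iff_mul_le (by omega), mul_comm, ← Nat.le_div_iff_mul_le h1] at h5
      rw [Nat.le_div_iff_mul_le hb, mul_comm, ← Nat.le_div_iff_mul_le h1] at h2
      omega
  have hsub : (Ioc 0 (n / (b + 1))).filter (d ∣ ·) ⊆ (Ioc 0 (n / b)).filter (d ∣ ·) :=
    filter_subset_filter _ (Ioc_subset_Ioc_right (Nat.div_le_div_left (by omega) hb))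
  rw [hset, cast_card_sdiff hsub, Nat.Ioc_filter_dvd_card_eq_div, Nat.Ioc_filter_dvd_card_eq_div,
    Nat.div_div_eq_div_mul, Nat.div_div_eq_div_mul]
  have key : ∀ m : ℕ, 0 < m → ((n / m : ℕ) : ℝ) ≤ n / m ∧ (n : ℝ) / m - 1 ≤ (n / m : ℕ) := by
    intro m hm
    have hm' : (0 : ℝ) < m := by exact_mod_cast hm
    refine ⟨Nat.cast_div_le, ?_⟩
    rw [sub_le_iff_le_add, div_le_iff₀ hm']
    have := Nat.lt_div_mul_add (a := n) hm
    have h' : (n : ℝ) < (n / m : ℕ) * m + m := by exact_mod_cast this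
    linarith
  have hb' : (0 : ℝ) < b := by exact_mod_cast hb
  have hd' : (0 : ℝ) < d := by exact_mod_cast hd
  have e : (n : ℝ) / (b * (b + 1)) / d = n / (b * d : ℕ) - n / ((b + 1) * d : ℕ) := by
    push_cast
    field_simp
    ring
  obtain ⟨h1, h2⟩ := key (b * d) (Nat.mul_pos hb hd)
  obtain ⟨h3, h4⟩ := key ((b + 1) * d) (Nat.mul_pos (by omega) hd)
  rw [e, abs_le]
  constructor <;> linarith

/-- The density of the `K`-rough numbers. -/
noncomputable def roughDensity (K : ℕ) : ℝ := ∏ p ∈ K.primesBelow, (1 - 1 / (p : ℝ))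

/-- The sum of the reciprocals of the primes below `K`. -/
noncomputable def primeRecipSum (K : ℕ) : ℝ := ∑ p ∈ K.primesBelow, 1 / (p : ℝ)

theorem sum_symmSum_sub_le {K : ℕ} {n b : ℕ} (hb : 0 < b) (i : ℕ) :
    |∑ t ∈ (Icc 1 n).filter (fun t => n / t = b),
        symmSum K.primesBelow (fun p => if p ∣ t then 1 else 0) i -
      n / (b * (b + 1)) * symmSum K.primesBelow (fun p => 1 / (p : ℝ)) i| ≤
      #(K.primesBelow.powersetCard i) := by
  have hprime : ∀ S ∈ K.primesBelow.powersetCard i, ∀ p ∈ S, p.Prime := fun S hS p hp =>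
    Nat.prime_of_mem_primesBelow ((mem_powersetCard.1 hS).1 hp)
  simp only [symmSum]
  rw [sum_comm, mul_sum, ← sum_sub_distrib, card_eq_sum_ones, Nat.cast_sum]
  refine (abs_sum_le_sum_abs _ _).trans (sum_le_sum fun S hS => ?_)
  have hpos : 0 < ∏ p ∈ S, p := prod_pos fun p hp => (hprime S hS p hp).pos
  rw [Nat.cast_one, sum_congr rfl fun t _ => prod_ite_dvd_eq (hprime S hS) t, sum_boole,
    filter_filter, prod_div_distrib, prod_const_one, ← Nat.cast_prod, mul_one_div]
  simp only [and_comm (a := n / _ = b)]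
  exact abs_card_multiples_sub_le hb hpos

theorem abs_roughCount_sub_le {K : ℕ} (hK : 0 < K) {n b : ℕ} (hb : 0 < b) (w : ℕ) :
    |roughCount K n b - n / (b * (b + 1)) * roughDensity K| ≤
      (K : ℝ) ^ w +
        2 * (n / (b * (b + 1))) * symmSum K.primesBelow (fun p => 1 / (p : ℝ)) w := by
  set P := K.primesBelow with hP
  set T := (Icc 1 n).filter (fun t => n / t = b) with hT
  set L : ℝ := n / (b * (b + 1)) with hL
  have hL0 : 0 ≤ L := by positivity
  let x : ℕ → ℕ → ℝ := fun t p => if p ∣ t then 1 else 0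
  let y : ℕ → ℝ := fun p => 1 / (p : ℝ)
  have hN : (roughCount K n b : ℝ) = ∑ t ∈ T, ∏ p ∈ P, (1 - x t p) := by
    have h1 : ∀ t, ∏ p ∈ P, (1 - x t p) = if IsRough K t then 1 else 0 := by
      intro t
      have : ∀ p, 1 - x t p = if ¬ p ∣ t then (1 : ℝ) else 0 := by
        intro p
        by_cases h : p ∣ t <;> simp [x, h]
      simp only [this]
      rw [prod_ite_zero, prod_const_one]
      exact if_congr Iff.rfl rfl rfl
    simp only [h1]
    rw [sum_boole, hT, filter_filter, roughCount]
    simp only [and_comm]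
  have hA : |∑ t ∈ T, ∏ p ∈ P, (1 - x t p) -
      ∑ t ∈ T, ∑ i ∈ range w, (-1) ^ i * symmSum P (x t) i| ≤ ∑ t ∈ T, symmSum P (x t) w := by
    rw [← sum_sub_distrib]
    refine (abs_sum_le_sum_abs _ _).trans (sum_le_sum fun t _ => ?_)
    refine abs_prod_one_sub_sub_sum_le P (x t) (fun p _ => ?_) (fun p _ => ?_) w <;>
      · simp only [x]; split_ifs <;> norm_num
  have hB : |∑ t ∈ T, ∑ i ∈ range w, (-1) ^ i * symmSum P (x t) i -
      L * ∑ i ∈ range w, (-1) ^ i * symmSum P y i| ≤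
        ∑ i ∈ range w, (#(P.powersetCard i) : ℝ) := by
    rw [sum_comm, mul_sum, ← sum_sub_distrib]
    refine (abs_sum_le_sum_abs _ _).trans (sum_le_sum fun i _ => ?_)
    rw [← mul_sum, mul_left_comm, ← mul_sub, abs_mul, abs_pow, abs_neg, abs_one, one_pow, one_mul]
    exact sum_symmSum_sub_le hb i
  have hC : |roughDensity K - ∑ i ∈ range w, (-1) ^ i * symmSum P y i| ≤ symmSum P y w := by
    refine abs_prod_one_sub_sub_sum_le P y (fun p _ => by positivity) (fun p hp => ?_) w
    have : (1 : ℝ) ≤ p := by exact_mod_cast (Nat.prime_of_mem_primesBelow hp).one_lt.le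
    exact (div_le_one (by linarith)).2 this
  have hD := sum_symmSum_sub_le (K := K) (n := n) hb w
  have hE : ∑ i ∈ range (w + 1), (#(P.powersetCard i) : ℝ) ≤ (K : ℝ) ^ w := by
    refine sum_card_powersetCard_le ?_ w
    have h2 : P ⊆ Ioo 0 K := fun p hp => by
      have := Nat.mem_primesBelow.1 hp
      exact mem_Ioo.2 ⟨this.2.pos, this.1⟩
    have := card_le_card h2
    rw [Nat.card_Ioo] at this
    omega
  rw [sum_range_succ] at hE
  have hC' := mul_le_mul_of_nonneg_left hC hL0
  rw [← abs_of_nonneg hL0, ← abs_mul, abs_of_nonneg hL0, mul_sub] at hC'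
  rw [hN]
  have hD' := (abs_le.1 hD).2
  change _ ≤ _ at hD'
  rw [abs_le] at hA hB hC' ⊢
  constructor <;> linarith [hA.1, hA.2, hB.1, hB.2, hC'.1, hC'.2]

/-- The size of the error terms for the primes below `K` with exponent `σ`. -/
noncomputable def rankinFactor (K : ℕ) (σ : ℝ) : ℝ :=
  Real.exp ((K : ℝ) ^ σ * (1 + primeRecipSum K))

theorem primeRecipSum_nonneg (K : ℕ) : 0 ≤ primeRecipSum K :=
  sum_nonneg fun _ _ => by positivity

theorem roughDensity_nonneg (K : ℕ) : 0 ≤ roughDensity K :=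
  prod_nonneg fun p hp => by
    have : (1 : ℝ) ≤ p := by exact_mod_cast (Nat.prime_of_mem_primesBelow hp).one_lt.le
    exact sub_nonneg.2 ((div_le_one (by linarith)).2 this)

theorem roughDensity_le_one (K : ℕ) : roughDensity K ≤ 1 :=
  prod_le_one (fun p hp => by
    have : (1 : ℝ) ≤ p := by exact_mod_cast (Nat.prime_of_mem_primesBelow hp).one_lt.le
    exact sub_nonneg.2 ((div_le_one (by linarith)).2 this)) fun p _ => by
    have : (0 : ℝ) ≤ 1 / p := by positivity
    linarith

theorem rpow_mul_exp_le_rankinFactor (K : ℕ) (σ : ℝ) :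
    (K : ℝ) ^ σ * Real.exp ((K : ℝ) ^ σ * primeRecipSum K) ≤ rankinFactor K σ := by
  rw [rankinFactor, mul_add, Real.exp_add, mul_one]
  gcongr
  linarith [Real.add_one_le_exp ((K : ℝ) ^ σ)]

theorem one_le_rankinFactor (K : ℕ) (σ : ℝ) : 1 ≤ rankinFactor K σ := by
  rw [rankinFactor, Real.one_le_exp_iff]
  have := primeRecipSum_nonneg K
  positivity

theorem abs_roughCount_sub_le_rpow {K : ℕ} (hK : 2 ≤ K) {n b : ℕ} (hb : 0 < b)
    (hbn : b ^ 2 ≤ n) {σ : ℝ} (hσ0 : 0 ≤ σ) (hσ1 : σ ≤ 1) :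
    |roughCount K n b - n / (b * (b + 1)) * roughDensity K| ≤
      3 * rankinFactor K σ * ((n : ℝ) / b ^ 2) ^ (1 - σ / 2) := by
  have hb' : (0 : ℝ) < b := by exact_mod_cast hb
  have hK1 : (1 : ℝ) < K := by exact_mod_cast hK
  have hK0 : (0 : ℝ) < K := by linarith
  set X : ℝ := (n : ℝ) / b ^ 2 with hX
  have hX1 : 1 ≤ X := by
    rw [hX, le_div_iff₀ (by positivity), one_mul]
    exact_mod_cast hbn
  have hX0 : 0 < X := by linarith
  obtain ⟨w, hw1, hw2⟩ := exists_nat_pow_near hX1 (one_lt_pow₀ hK1 two_ne_zero)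
  refine (abs_roughCount_sub_le (by omega) hb w).trans ?_
  have hLX : (n : ℝ) / (b * (b + 1)) ≤ X := by
    rw [hX]
    gcongr
    nlinarith
  have hR := one_le_rankinFactor K σ
  have h1 : (K : ℝ) ^ w ≤ X ^ (1 - σ / 2) := by
    calc (K : ℝ) ^ w = (((K : ℝ) ^ 2) ^ w) ^ (1 / 2 : ℝ) := by
          rw [← pow_mul, mul_comm, pow_mul, ← Real.sqrt_eq_rpow, Real.sqrt_sq (by positivity)]
      _ ≤ X ^ (1 / 2 : ℝ) := by gcongr
      _ ≤ X ^ (1 - σ / 2) := Real.rpow_le_rpow_of_exponent_le hX1 (by linarith)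
  set e := symmSum K.primesBelow (fun p => 1 / (p : ℝ)) w with he
  have he0 : 0 ≤ e := sum_nonneg fun S _ => prod_nonneg fun p _ => by positivity
  have h2 : e ≤ rankinFactor K σ * X ^ (-(σ / 2)) := by
    have h3 := pow_mul_symmSum_le K.primesBelow (fun p => 1 / (p : ℝ))
      (fun p _ => by positivity) (z := (K : ℝ) ^ σ) (by positivity) w
    have h4 : X ^ (σ / 2) ≤ (K : ℝ) ^ σ * ((K : ℝ) ^ σ) ^ w := by
      calc X ^ (σ / 2) ≤ (((K : ℝ) ^ 2) ^ (w + 1)) ^ (σ / 2) := by gcongr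
        _ = (K : ℝ) ^ σ * ((K : ℝ) ^ σ) ^ w := by
          rw [← pow_succ', ← pow_mul, ← Real.rpow_natCast, ← Real.rpow_mul hK0.le,
            ← Real.rpow_natCast, ← Real.rpow_mul hK0.le]
          congr 1
          push_cast
          ring
    rw [Real.rpow_neg hX0.le, ← div_eq_mul_inv, le_div_iff₀ (by positivity)]
    calc e * X ^ (σ / 2) ≤ e * ((K : ℝ) ^ σ * ((K : ℝ) ^ σ) ^ w) := by gcongr
      _ = (K : ℝ) ^ σ * (((K : ℝ) ^ σ) ^ w * e) := by ring
      _ ≤ (K : ℝ) ^ σ * Real.exp ((K : ℝ) ^ σ * primeRecipSum K) := by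
        gcongr
        exact h3
      _ ≤ rankinFactor K σ := rpow_mul_exp_le_rankinFactor K σ
  calc (K : ℝ) ^ w + 2 * (n / (b * (b + 1))) * e
      ≤ X ^ (1 - σ / 2) + 2 * X * (rankinFactor K σ * X ^ (-(σ / 2))) := by
        gcongr
    _ = X ^ (1 - σ / 2) + 2 * rankinFactor K σ * X ^ (1 - σ / 2) := by
        rw [show (1 - σ / 2 : ℝ) = 1 + -(σ / 2) by ring, Real.rpow_add hX0, Real.rpow_one]
        ring
    _ ≤ 3 * rankinFactor K σ * X ^ (1 - σ / 2) := by
        have : 0 ≤ X ^ (1 - σ / 2) := by positivity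
        nlinarith

theorem inv_one_sub_le_exp {x : ℝ} (h1 : x ≤ 3 / 4) (h0 : 0 ≤ x) :
    (1 - x)⁻¹ ≤ Real.exp (4 * x) := by
  refine le_trans ?_ (Real.add_one_le_exp (4 * x))
  rw [inv_le_iff_one_le_mul₀ (by linarith)]
  nlinarith

theorem rpow_sub_one_le_of_two_le {p σ : ℝ} (hp : 2 ≤ p) (hσ : σ ≤ 1 / 2) :
    p ^ (σ - 1) ≤ 3 / 4 := by
  calc p ^ (σ - 1) ≤ p ^ (-(1 / 2) : ℝ) :=
        Real.rpow_le_rpow_of_exponent_le (by linarith) (by linarith)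
    _ ≤ 2 ^ (-(1 / 2) : ℝ) := Real.rpow_le_rpow_of_nonpos (by norm_num) hp (by norm_num)
    _ ≤ 3 / 4 := by
        rw [Real.rpow_neg (by norm_num), ← Real.sqrt_eq_rpow]
        refine inv_le_of_inv_le₀ (by norm_num) (Real.le_sqrt_of_sq_le (by norm_num))

theorem sum_smooth_rpow_le {K : ℕ} {σ : ℝ} (hσ0 : 0 ≤ σ) (hσ : σ ≤ 1 / 2) (A : Finset ℕ)
    (hA : ∀ s ∈ A, s ∈ Nat.smoothNumbers K) :
    ∑ s ∈ A, (s : ℝ) ^ (σ - 1) ≤ Real.exp (4 * ((K : ℝ) ^ σ * primeRecipSum K)) := by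
  let f : ℕ →* ℝ :=
    { toFun := fun s => (s : ℝ) ^ (σ - 1)
      map_one' := by simp
      map_mul' := fun a b => by
        rw [Nat.cast_mul, Real.mul_rpow (Nat.cast_nonneg a) (Nat.cast_nonneg b)] }
  have hf : ∀ s : ℕ, f s = (s : ℝ) ^ (σ - 1) := fun s => rfl
  have hf0 : ∀ s : ℕ, 0 ≤ f s := fun s => by rw [hf]; positivity
  have hle : ∀ {p : ℕ}, p.Prime → f p ≤ 3 / 4 := fun hp =>
    rpow_sub_one_le_of_two_le (by exact_mod_cast hp.two_le) hσ
  have h := (EulerProduct.summable_and_hasSum_smoothNumbers_prod_primesBelow_geometric (f := f)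
    (fun hp => by rw [Real.norm_of_nonneg (hf0 _)]; linarith [hle hp]) K).2
  calc ∑ s ∈ A, (s : ℝ) ^ (σ - 1)
      = ∑ s ∈ A.subtype (· ∈ Nat.smoothNumbers K), f s := by
        rw [sum_subtype_of_mem (fun s => f s) hA]
        rfl
    _ ≤ ∏ p ∈ K.primesBelow, (1 - f p)⁻¹ :=
        sum_le_hasSum _ (fun s _ => hf0 s) h
    _ ≤ ∏ p ∈ K.primesBelow, Real.exp (4 * f p) := by
        refine prod_le_prod (fun p hp => ?_) fun p hp => ?_
        · exact inv_nonneg.2 (by linarith [hle (Nat.prime_of_mem_primesBelow hp)])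
        · exact inv_one_sub_le_exp (hle (Nat.prime_of_mem_primesBelow hp)) (hf0 p)
    _ ≤ Real.exp (4 * ((K : ℝ) ^ σ * primeRecipSum K)) := by
        rw [← Real.exp_sum, ← mul_sum, primeRecipSum, mul_sum (a := (K : ℝ) ^ σ)]
        refine Real.exp_le_exp.2 (mul_le_mul_of_nonneg_left (sum_le_sum fun p hp => ?_)
          (by norm_num))
        obtain ⟨hpK, hp⟩ := Nat.mem_primesBelow.1 hp
        have hp0 : (0 : ℝ) < p := by exact_mod_cast hp.pos
        rw [hf, Real.rpow_sub hp0, Real.rpow_one, mul_one_div]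
        gcongr

theorem mem_smoothBand_bounds {K κ b s : ℕ} (h : s ∈ smoothBand K κ b) :
    0 < s ∧ s ≤ b ∧ s ∈ Nat.smoothNumbers K ∧ s * κ ≤ b ∧ b < s * K := by
  simp only [smoothBand, mem_filter, mem_Icc] at h
  obtain ⟨⟨h1, h2⟩, hs, h3, h4⟩ := h
  refine ⟨h1, h2, hs, ?_, ?_⟩
  · rwa [Nat.le_div_iff_mul_le h1, mul_comm] at h3
  · rwa [Nat.div_lt_iff_lt_mul h1, mul_comm] at h4

theorem sum_card_smoothBand_mul_rpow_le {k : ℕ} (hk : 0 < k) {σ : ℝ} (hσ0 : 0 ≤ σ)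
    (hσ : σ ≤ 1 / 2) (M : ℕ) :
    ∑ b ∈ range M, #(smoothBand (2 * k) k b) * (b : ℝ) ^ (σ - 2) ≤
      (k : ℝ) ^ (σ - 1) *
        Real.exp (4 * (((2 * k : ℕ) : ℝ) ^ σ * primeRecipSum (2 * k))) := by
  have hk' : (0 : ℝ) < k := by exact_mod_cast hk
  set A := (Icc 1 M).filter (· ∈ Nat.smoothNumbers (2 * k)) with hA
  calc ∑ b ∈ range M, #(smoothBand (2 * k) k b) * (b : ℝ) ^ (σ - 2)
      = ∑ b ∈ range M, ∑ s ∈ smoothBand (2 * k) k b, (b : ℝ) ^ (σ - 2) := by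
        simp [sum_const, nsmul_eq_mul]
    _ = ∑ s ∈ A, ∑ b ∈ (range M).filter (fun b => s ∈ smoothBand (2 * k) k b),
          (b : ℝ) ^ (σ - 2) := by
        refine sum_comm' fun b s => ?_
        simp only [mem_filter, mem_range, hA, mem_Icc]
        constructor
        · rintro ⟨hb, hs⟩
          have := mem_smoothBand_bounds hs
          exact ⟨⟨hb, hs⟩, ⟨this.1, by omega⟩, this.2.2.1⟩
        · rintro ⟨h, _⟩
          exact h
    _ ≤ ∑ s ∈ A, (k : ℝ) ^ (σ - 1) * (s : ℝ) ^ (σ - 1) := by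
        refine sum_le_sum fun s hs => ?_
        have hs1 : 0 < s := (mem_Icc.1 (mem_filter.1 hs).1).1
        have hs' : (0 : ℝ) < s := by exact_mod_cast hs1
        calc ∑ b ∈ (range M).filter (fun b => s ∈ smoothBand (2 * k) k b), (b : ℝ) ^ (σ - 2)
            ≤ ∑ b ∈ Ico (s * k) (s * (2 * k)), ((s : ℝ) * k) ^ (σ - 2) := by
              refine (sum_le_sum fun b hb => ?_).trans
                (sum_le_sum_of_subset_of_nonneg (fun b hb => ?_) fun _ _ _ => by positivity)
              · have hb := (mem_smoothBand_bounds (mem_filter.1 hb).2).2.2.2.1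
                exact Real.rpow_le_rpow_of_nonpos (by positivity) (by exact_mod_cast hb)
                  (by linarith)
              · have hb := (mem_smoothBand_bounds (mem_filter.1 hb).2).2.2.2
                exact mem_Ico.2 hb
          _ = ((s : ℝ) * k) * ((s : ℝ) * k) ^ (σ - 2) := by
              rw [sum_const, Nat.card_Ico, nsmul_eq_mul,
                show s * (2 * k) - s * k = s * k by rw [mul_left_comm]; omega]
              push_cast
              rfl
          _ = (k : ℝ) ^ (σ - 1) * (s : ℝ) ^ (σ - 1) := by
              rw [mul_comm (k ^ (σ - 1) : ℝ), ← Real.mul_rpow hs'.le hk'.le,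
                show σ - 1 = 1 + (σ - 2) by ring, Real.rpow_add (by positivity), Real.rpow_one]
    _ ≤ _ := by
        rw [← mul_sum]
        gcongr
        exact sum_smooth_rpow_le hσ0 hσ A fun s hs => (mem_filter.1 hs).2

theorem sum_roughCount_le (K n : ℕ) {m : ℕ} (hm : 0 < m) (B : Finset ℕ)
    (hB : ∀ b ∈ B, m ≤ b) : ∑ b ∈ B, roughCount K n b ≤ n / m := by
  have h := card_eq_sum_card_fiberwise (f := fun t => n / t) (t := B)
    (s := (Icc 1 n).filter fun t => IsRough K t ∧ n / t ∈ B)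
    fun t ht => (mem_filter.1 (mem_coe.1 ht)).2.2
  calc ∑ b ∈ B, roughCount K n b
      = #((Icc 1 n).filter fun t => IsRough K t ∧ n / t ∈ B) := by
        rw [h]
        refine sum_congr rfl fun b hb => ?_
        rw [roughCount]
        congr 1
        ext t
        simp only [mem_filter]
        constructor
        · rintro ⟨h1, h2, rfl⟩
          exact ⟨⟨h1, h2, hb⟩, rfl⟩
        · rintro ⟨⟨h1, h2, _⟩, h3⟩
          exact ⟨h1, h2, h3⟩
    _ ≤ #(Ioc 0 (n / m)) := by
        refine card_le_card fun t ht => ?_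
        obtain ⟨ht, -, htB⟩ := mem_filter.1 ht
        have ht := (mem_Icc.1 ht).1
        have h2 := hB _ htB
        rw [Nat.le_div_iff_mul_le ht] at h2
        rw [mem_Ioc, Nat.le_div_iff_mul_le hm, mul_comm]
        exact ⟨ht, h2⟩
    _ = n / m := by simp

theorem sum_card_smoothBand_mul_roughCount_le {k n : ℕ} (hk : 0 < k) (hn : 0 < n) {σ : ℝ}
    (hσ0 : 0 ≤ σ) (hσ : σ ≤ 1 / 2) (M : ℕ) :
    ∑ b ∈ (range M).filter (fun b => n < b ^ 2),
        (#(smoothBand (2 * k) k b) : ℝ) * roughCount (2 * k) n b ≤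
      2 * (n : ℝ) ^ (1 - σ / 2) * ((k : ℝ) ^ (σ - 1) *
        Real.exp (4 * (((2 * k : ℕ) : ℝ) ^ σ * primeRecipSum (2 * k)))) := by
  have hk' : (0 : ℝ) < k := by exact_mod_cast hk
  have hn' : (0 : ℝ) < n := by exact_mod_cast hn
  set A := (Icc 1 M).filter (· ∈ Nat.smoothNumbers (2 * k)) with hA
  set B := (range M).filter (fun b => n < b ^ 2) with hB
  calc ∑ b ∈ B, (#(smoothBand (2 * k) k b) : ℝ) * roughCount (2 * k) n b
      = ∑ b ∈ B, ∑ s ∈ smoothBand (2 * k) k b, (roughCount (2 * k) n b : ℝ) := by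
        simp [sum_const, nsmul_eq_mul]
    _ = ∑ s ∈ A, ∑ b ∈ B.filter (fun b => s ∈ smoothBand (2 * k) k b),
          (roughCount (2 * k) n b : ℝ) := by
        refine sum_comm' fun b s => ?_
        simp only [mem_filter, mem_range, hA, hB, mem_Icc]
        constructor
        · rintro ⟨hb, hs⟩
          have := mem_smoothBand_bounds hs
          exact ⟨⟨hb, hs⟩, ⟨this.1, by omega⟩, this.2.2.1⟩
        · rintro ⟨h, _⟩
          exact h
    _ ≤ ∑ s ∈ A, 2 * (n : ℝ) ^ (1 - σ / 2) * ((k : ℝ) ^ (σ - 1) * (s : ℝ) ^ (σ - 1)) := by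
        refine sum_le_sum fun s hs => ?_
        have hs1 : 0 < s := (mem_Icc.1 (mem_filter.1 hs).1).1
        have hs' : (0 : ℝ) < s := by exact_mod_cast hs1
        rcases (B.filter (fun b => s ∈ smoothBand (2 * k) k b)).eq_empty_or_nonempty with
          h0 | ⟨b, hb⟩
        · rw [h0, sum_empty]
          positivity
        obtain ⟨hbB, hbs⟩ := mem_filter.1 hb
        have hbn : n < b ^ 2 := (mem_filter.1 hbB).2
        have hsn : n < (s * (2 * k)) ^ 2 :=
          hbn.trans (Nat.pow_lt_pow_left (mem_smoothBand_bounds hbs).2.2.2.2 two_ne_zero)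
        have hsn' : (n : ℝ) ≤ (2 * (s * k)) ^ 2 := by
          have : (n : ℝ) < (s * (2 * k)) ^ 2 := by exact_mod_cast hsn
          nlinarith
        have h1 : (n : ℝ) ^ (σ / 2) ≤ 2 * ((s : ℝ) * k) ^ σ := by
          calc (n : ℝ) ^ (σ / 2) ≤ ((2 * ((s : ℝ) * k)) ^ 2) ^ (σ / 2) := by gcongr
            _ = 2 ^ σ * ((s : ℝ) * k) ^ σ := by
              rw [← Real.rpow_natCast, ← Real.rpow_mul (by positivity),
                ← Real.mul_rpow (by norm_num) (by positivity)]
              congr 1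
              push_cast
              ring
            _ ≤ 2 * ((s : ℝ) * k) ^ σ := by
              gcongr
              calc (2 : ℝ) ^ σ ≤ 2 ^ (1 : ℝ) :=
                    Real.rpow_le_rpow_of_exponent_le (by norm_num) (by linarith)
                _ = 2 := Real.rpow_one 2
        calc ∑ b ∈ B.filter (fun b => s ∈ smoothBand (2 * k) k b), (roughCount (2 * k) n b : ℝ)
            ≤ (n : ℝ) / (s * k) := by
              have h := sum_roughCount_le (2 * k) n (Nat.mul_pos hs1 hk)
                (B.filter (fun b => s ∈ smoothBand (2 * k) k b))
                fun b hb => (mem_smoothBand_bounds (mem_filter.1 hb).2).2.2.2.1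
              rw [← Nat.cast_sum]
              refine (Nat.cast_le.2 h).trans (Nat.cast_div_le.trans ?_)
              push_cast
              rfl
          _ = (n : ℝ) ^ (1 - σ / 2) * (n : ℝ) ^ (σ / 2) / (s * k) := by
              rw [← Real.rpow_add hn', sub_add_cancel, Real.rpow_one]
          _ ≤ (n : ℝ) ^ (1 - σ / 2) * (2 * ((s : ℝ) * k) ^ σ) / (s * k) := by gcongr
          _ = 2 * (n : ℝ) ^ (1 - σ / 2) * ((k : ℝ) ^ (σ - 1) * (s : ℝ) ^ (σ - 1)) := by
              rw [mul_comm (k ^ (σ - 1) : ℝ), ← Real.mul_rpow hs'.le hk'.le,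
                Real.rpow_sub (mul_pos hs' hk'), Real.rpow_one]
              ring
    _ ≤ _ := by
        rw [← mul_sum, ← mul_sum]
        gcongr
        exact sum_smooth_rpow_le hσ0 hσ A fun s hs => (mem_filter.1 hs).2

/-- The limiting density of `topFree r (2 * k) n - topFree r k n`. -/
noncomputable def scaleDensity (r k : ℕ) : ℝ :=
  ∑' b : ℕ, bandWeight r (2 * k) k b * (1 / (b * (b + 1)) * roughDensity (2 * k))

theorem bandWeight_zero (r : ℕ) {K k : ℕ} (h : k ≤ K) : bandWeight r K k 0 = 0 := by
  refine le_antisymm ((bandWeight_le r K k 0).trans ?_) (bandWeight_nonneg r 0 h)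
  simp [smoothBand]

theorem scaleDensity_term_nonneg (r k b : ℕ) :
    0 ≤ bandWeight r (2 * k) k b * (1 / (b * (b + 1)) * roughDensity (2 * k)) :=
  mul_nonneg (bandWeight_nonneg r b (by omega))
    (mul_nonneg (by positivity) (roughDensity_nonneg _))

theorem summable_scaleDensity (r : ℕ) {k : ℕ} (hk : 0 < k) :
    Summable fun b : ℕ =>
      bandWeight r (2 * k) k b * (1 / (b * (b + 1)) * roughDensity (2 * k)) := by
  refine summable_of_sum_range_le (scaleDensity_term_nonneg r k) fun M =>
    (sum_le_sum fun b _ => ?_).trans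
      (sum_card_smoothBand_mul_rpow_le hk le_rfl (by norm_num) M)
  have h0 := roughDensity_nonneg (2 * k)
  have h1 := roughDensity_le_one (2 * k)
  have h2 := bandWeight_nonneg r b (show k ≤ 2 * k by omega)
  have h3 := bandWeight_le r (2 * k) k b
  refine mul_le_mul h3 ?_ (by positivity) (by positivity)
  rcases Nat.eq_zero_or_pos b with rfl | hb
  · simp
  have hb' : (0 : ℝ) < b := by exact_mod_cast hb
  calc (1 / (b * (b + 1)) * roughDensity (2 * k) : ℝ) ≤ 1 / (b * (b + 1)) * 1 := by gcongr
    _ ≤ 1 / (b * b) := by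
      rw [mul_one]
      gcongr
      linarith
    _ = (b : ℝ) ^ (0 - 2 : ℝ) := by
      rw [zero_sub, Real.rpow_neg hb'.le]
      norm_num
      ring

theorem abs_bandWeight_mul_sub_le (r : ℕ) {k n : ℕ} (hk : 0 < k) (hn : 0 < n) {σ : ℝ}
    (hσ0 : 0 ≤ σ) (hσ : σ ≤ 1 / 2) (b : ℕ) :
    |bandWeight r (2 * k) k b * roughCount (2 * k) n b -
        n * (bandWeight r (2 * k) k b * (1 / (b * (b + 1)) * roughDensity (2 * k)))| ≤
      3 * rankinFactor (2 * k) σ * (n : ℝ) ^ (1 - σ / 2) *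
          (#(smoothBand (2 * k) k b) * (b : ℝ) ^ (σ - 2)) +
        if n < b ^ 2 then (#(smoothBand (2 * k) k b) : ℝ) * roughCount (2 * k) n b else 0 := by
  have hR := one_le_rankinFactor (2 * k) σ
  have hn' : (0 : ℝ) < n := by exact_mod_cast hn
  have hW := bandWeight_nonneg r b (show k ≤ 2 * k by omega)
  have hWV := bandWeight_le r (2 * k) k b
  rcases Nat.eq_zero_or_pos b with rfl | hb
  · rw [bandWeight_zero r (by omega)]
    simp only [zero_mul, mul_zero, sub_zero, abs_zero]
    split_ifs <;> positivity
  have hb' : (0 : ℝ) < b := by exact_mod_cast hb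
  have hpow : ((n : ℝ) / b ^ 2) ^ (1 - σ / 2) = (n : ℝ) ^ (1 - σ / 2) * (b : ℝ) ^ (σ - 2) := by
    rw [Real.div_rpow hn'.le (by positivity), ← Real.rpow_natCast (b : ℝ) 2,
      ← Real.rpow_mul hb'.le, div_eq_mul_inv, ← Real.rpow_neg hb'.le]
    congr 2
    push_cast
    ring
  rw [show (bandWeight r (2 * k) k b * roughCount (2 * k) n b -
        n * (bandWeight r (2 * k) k b * (1 / (b * (b + 1)) * roughDensity (2 * k))) : ℝ) =
      bandWeight r (2 * k) k b *
        (roughCount (2 * k) n b - n / (b * (b + 1)) * roughDensity (2 * k)) by ring,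
    abs_mul, abs_of_nonneg hW]
  split_ifs with hbn
  · have hx0 : (0 : ℝ) ≤ n / (b * (b + 1)) * roughDensity (2 * k) :=
      mul_nonneg (by positivity) (roughDensity_nonneg _)
    have hX1 : (n : ℝ) / b ^ 2 ≤ 1 := by
      rw [div_le_one (by positivity)]
      exact_mod_cast hbn.le
    have hx : (n : ℝ) / (b * (b + 1)) * roughDensity (2 * k) ≤
        3 * rankinFactor (2 * k) σ * ((n : ℝ) / b ^ 2) ^ (1 - σ / 2) := by
      calc (n : ℝ) / (b * (b + 1)) * roughDensity (2 * k) ≤ n / b ^ 2 * 1 := by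
            have := roughDensity_le_one (2 * k)
            have := roughDensity_nonneg (2 * k)
            gcongr
            nlinarith
        _ = ((n : ℝ) / b ^ 2) ^ (1 : ℝ) := by rw [mul_one, Real.rpow_one]
        _ ≤ ((n : ℝ) / b ^ 2) ^ (1 - σ / 2) :=
            Real.rpow_le_rpow_of_exponent_ge (by positivity) hX1 (by linarith)
        _ ≤ 3 * rankinFactor (2 * k) σ * ((n : ℝ) / b ^ 2) ^ (1 - σ / 2) :=
            le_mul_of_one_le_left (by positivity) (by linarith)
    have hd : |(roughCount (2 * k) n b : ℝ) - n / (b * (b + 1)) * roughDensity (2 * k)| ≤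
        3 * rankinFactor (2 * k) σ * ((n : ℝ) / b ^ 2) ^ (1 - σ / 2) +
          roughCount (2 * k) n b := by
      have : (0 : ℝ) ≤ roughCount (2 * k) n b := by positivity
      rw [abs_le]
      constructor <;> linarith
    refine (mul_le_mul hWV hd (abs_nonneg _) (by positivity)).trans (le_of_eq ?_)
    rw [hpow]
    ring
  · have hd := abs_roughCount_sub_le_rpow (show 2 ≤ 2 * k by omega) hb (not_lt.1 hbn) hσ0
      (by linarith)
    refine (mul_le_mul hWV hd (abs_nonneg _) (by positivity)).trans (le_of_eq ?_)
    rw [hpow]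
    ring

theorem roughCount_eq_zero {K n b : ℕ} (h : n < b) : roughCount K n b = 0 := by
  rw [roughCount, card_eq_zero, filter_eq_empty_iff]
  rintro t - ⟨-, ht⟩
  have := Nat.div_le_self n t
  omega

theorem abs_topFree_sub_le (r : ℕ) {k n : ℕ} (hk : 0 < k) (hn : 0 < n) {σ : ℝ}
    (hσ0 : 0 ≤ σ) (hσ : σ ≤ 1 / 2) :
    |(topFree r (2 * k) n : ℝ) - topFree r k n - scaleDensity r k * n| ≤
      5 * (n / k) * (n : ℝ) ^ (-(σ / 2)) *
        Real.exp (6 * (((2 * k : ℕ) : ℝ) ^ σ * (1 + primeRecipSum (2 * k)))) := by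
  have hk' : (0 : ℝ) < k := by exact_mod_cast hk
  have hn' : (0 : ℝ) < n := by exact_mod_cast hn
  have hR := one_le_rankinFactor (2 * k) σ
  set E := Real.exp (4 * (((2 * k : ℕ) : ℝ) ^ σ * primeRecipSum (2 * k))) with hE
  have hlim : Filter.Tendsto (fun M => |∑ b ∈ range M,
      (bandWeight r (2 * k) k b * roughCount (2 * k) n b -
        n * (bandWeight r (2 * k) k b * (1 / (b * (b + 1)) * roughDensity (2 * k))))|)
      Filter.atTop
      (nhds |(topFree r (2 * k) n : ℝ) - topFree r k n - scaleDensity r k * n|) := by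
    refine Filter.Tendsto.abs ?_
    simp only [sum_sub_distrib, ← mul_sum]
    rw [mul_comm (scaleDensity r k)]
    refine Filter.Tendsto.sub ?_
      ((summable_scaleDensity r hk).hasSum.tendsto_sum_nat.const_mul _)
    refine tendsto_const_nhds.congr' ?_
    filter_upwards [Filter.eventually_gt_atTop n] with M hM
    rw [topFree_sub_topFree_eq_sum r n (show k ≤ 2 * k by omega)]
    refine sum_subset (fun b hb => ?_) fun b _ hb => ?_
    · have := (mem_Icc.1 hb).2
      exact mem_range.2 (by omega)
    · rw [mem_Icc, not_and_or] at hb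
      rcases hb with hb | hb
      · rw [show b = 0 by omega, bandWeight_zero r (by omega), zero_mul]
      · rw [roughCount_eq_zero (by omega), Nat.cast_zero, mul_zero]
  refine le_of_tendsto' hlim fun M => ?_
  have h1 := sum_card_smoothBand_mul_rpow_le hk hσ0 hσ M
  have h2 := sum_card_smoothBand_mul_roughCount_le hk hn hσ0 hσ M
  rw [← hE] at h1 h2
  have hkσ : (k : ℝ) ^ σ ≤ Real.exp (((2 * k : ℕ) : ℝ) ^ σ) := by
    calc (k : ℝ) ^ σ ≤ ((2 * k : ℕ) : ℝ) ^ σ := by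
          gcongr
          omega
      _ ≤ Real.exp (((2 * k : ℕ) : ℝ) ^ σ) := by
          linarith [Real.add_one_le_exp (((2 * k : ℕ) : ℝ) ^ σ)]
  have hP := primeRecipSum_nonneg (2 * k)
  calc _ ≤ ∑ b ∈ range M, (3 * rankinFactor (2 * k) σ * (n : ℝ) ^ (1 - σ / 2) *
          (#(smoothBand (2 * k) k b) * (b : ℝ) ^ (σ - 2)) +
        if n < b ^ 2 then (#(smoothBand (2 * k) k b) : ℝ) * roughCount (2 * k) n b else 0) :=
        (abs_sum_le_sum_abs _ _).trans
          (sum_le_sum fun b _ => abs_bandWeight_mul_sub_le r hk hn hσ0 hσ b)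
    _ ≤ 3 * rankinFactor (2 * k) σ * (n : ℝ) ^ (1 - σ / 2) * ((k : ℝ) ^ (σ - 1) * E) +
          2 * (n : ℝ) ^ (1 - σ / 2) * ((k : ℝ) ^ (σ - 1) * E) := by
        rw [sum_add_distrib, ← mul_sum, ← sum_filter]
        gcongr
    _ ≤ 5 * rankinFactor (2 * k) σ * (n : ℝ) ^ (1 - σ / 2) * ((k : ℝ) ^ (σ - 1) * E) := by
        have : 0 ≤ (n : ℝ) ^ (1 - σ / 2) * ((k : ℝ) ^ (σ - 1) * E) := by positivity
        nlinarith
    _ = 5 * (n / k) * (n : ℝ) ^ (-(σ / 2)) * (k ^ σ * (rankinFactor (2 * k) σ * E)) := by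
        rw [sub_eq_add_neg, Real.rpow_add hn', Real.rpow_one, Real.rpow_sub hk', Real.rpow_one]
        ring
    _ ≤ 5 * (n / k) * (n : ℝ) ^ (-(σ / 2)) *
          (Real.exp (((2 * k : ℕ) : ℝ) ^ σ) * (rankinFactor (2 * k) σ * E)) := by
        gcongr
    _ ≤ _ := by
        gcongr
        rw [rankinFactor, hE, ← Real.exp_add, ← Real.exp_add]
        refine Real.exp_le_exp.2 ?_
        have h3 : 0 ≤ ((2 * k : ℕ) : ℝ) ^ σ := by positivity
        nlinarith [mul_nonneg h3 hP]

theorem primeRecipSum_two_pow_succ_le (J : ℕ) (hJ : 0 < J) :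
    primeRecipSum (2 ^ (J + 1)) ≤ primeRecipSum (2 ^ J) + 4 / J := by
  have hJ' : (0 : ℝ) < J := by exact_mod_cast hJ
  set D := (2 ^ (J + 1)).primesBelow \ (2 ^ J).primesBelow with hD
  have hDmem : ∀ p ∈ D, 2 ^ J ≤ p := fun p hp => by
    simp only [hD, mem_sdiff, Nat.mem_primesBelow, not_and] at hp
    by_contra h
    exact hp.2 (by omega) hp.1.2
  have hcard : J * #D ≤ 2 ^ (J + 2) := by
    have h : 2 ^ (J * #D) ≤ 2 ^ 2 ^ (J + 2) := by
      calc 2 ^ (J * #D) = (2 ^ J) ^ #D := pow_mul _ _ _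
        _ ≤ ∏ p ∈ D, p := pow_card_le_prod D (fun p => p) _ hDmem
        _ ≤ primorial (2 ^ (J + 1)) := by
          refine prod_le_prod_of_subset_of_one_le' (fun p hp => ?_) fun p hp _ => ?_
          · simp only [hD, mem_sdiff, Nat.mem_primesBelow] at hp
            exact mem_filter.2 ⟨mem_range.2 (by omega), hp.1.2⟩
          · exact (mem_filter.1 hp).2.one_lt.le
        _ ≤ 4 ^ 2 ^ (J + 1) := primorial_le_four_pow _
        _ = 2 ^ 2 ^ (J + 2) := by
          rw [show 4 = 2 ^ 2 by norm_num, ← pow_mul]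
          congr 1
          ring
    exact (Nat.pow_le_pow_iff_right (by norm_num)).1 h
  have hsub : (2 ^ J).primesBelow ⊆ (2 ^ (J + 1)).primesBelow := fun p hp => by
    simp only [Nat.mem_primesBelow] at hp ⊢
    exact ⟨hp.1.trans (Nat.pow_lt_pow_right (by norm_num) (by omega)), hp.2⟩
  rw [primeRecipSum, primeRecipSum, ← sum_sdiff hsub, add_comm]
  gcongr
  calc ∑ p ∈ D, 1 / (p : ℝ) ≤ ∑ p ∈ D, 1 / (2 : ℝ) ^ J := by
        refine sum_le_sum fun p hp => ?_
        gcongr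
        exact_mod_cast hDmem p hp
    _ = #D / 2 ^ J := by rw [sum_const, nsmul_eq_mul, mul_one_div]
    _ ≤ 4 / J := by
        rw [div_le_div_iff₀ (by positivity) hJ']
        have : (J : ℝ) * #D ≤ 2 ^ (J + 2) := by exact_mod_cast hcard
        rw [pow_add] at this
        linarith

theorem primeRecipSum_two_pow_le (J : ℕ) :
    primeRecipSum (2 ^ (J + 1)) ≤ 4 * (1 + Real.log J) := by
  have h : primeRecipSum (2 ^ (J + 1)) ≤ 4 * (harmonic J : ℝ) := by
    induction J with
    | zero =>
      simp [primeRecipSum]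
    | succ J ih =>
      refine (primeRecipSum_two_pow_succ_le (J + 1) J.succ_pos).trans ?_
      rw [harmonic_succ]
      push_cast at ih ⊢
      rw [div_eq_mul_inv]
      linarith
  have := harmonic_le_one_add_log J
  linarith

theorem scaleDensity_nonneg (r k : ℕ) : 0 ≤ scaleDensity r k :=
  tsum_nonneg fun b => scaleDensity_term_nonneg r k b

theorem scaleDensity_le (r : ℕ) {k : ℕ} (hk : 0 < k) : scaleDensity r k ≤ 1 / k := by
  have hk' : (0 : ℝ) < k := by exact_mod_cast hk
  set C := 5 * (1 / (k : ℝ)) *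
    Real.exp (6 * (((2 * k : ℕ) : ℝ) ^ (1 / 2 : ℝ) * (1 + primeRecipSum (2 * k)))) with hC
  have hlim : Filter.Tendsto (fun n : ℕ => 1 / (k : ℝ) + C * (n : ℝ) ^ (-(1 / 2 / 2 : ℝ)))
      Filter.atTop (nhds (1 / k + C * 0)) :=
    (((tendsto_rpow_neg_atTop (by norm_num)).comp tendsto_natCast_atTop_atTop).const_mul
      C).const_add _
  rw [mul_zero, add_zero] at hlim
  refine ge_of_tendsto hlim ?_
  filter_upwards [Filter.eventually_gt_atTop 0] with n hn
  have hn' : (0 : ℝ) < n := by exact_mod_cast hn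
  have h1 := (abs_le.1 (abs_topFree_sub_le r hk hn (by norm_num : (0 : ℝ) ≤ 1 / 2) le_rfl)).1
  have h2 : (topFree r (2 * k) n : ℝ) - topFree r k n ≤ n / k := by
    have h : topFree r (2 * k) n ≤ topFree r k n + n / k :=
      (topFree_le_fInFork r n _).trans (fInFork_le_topFree_add r n hk)
    have h' : (topFree r (2 * k) n : ℝ) ≤ topFree r k n + (n / k : ℕ) := by exact_mod_cast h
    have := Nat.cast_div_le (α := ℝ) (m := n) (n := k)
    linarith
  rw [← mul_le_mul_iff_left₀ hn']
  calc scaleDensity r k * n ≤ n / k + 5 * (n / k) * (n : ℝ) ^ (-(1 / 2 / 2 : ℝ)) *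
        Real.exp (6 * (((2 * k : ℕ) : ℝ) ^ (1 / 2 : ℝ) * (1 + primeRecipSum (2 * k)))) := by
        linarith
    _ = (1 / k + C * (n : ℝ) ^ (-(1 / 2 / 2 : ℝ))) * n := by
        rw [hC]
        ring

/-- The asymptotic density of the largest `r`-in-fork-free subsets of `{1, …, n}`. -/
noncomputable def forkDensity (r : ℕ) : ℝ := ∑' j : ℕ, scaleDensity r (2 ^ j)

theorem scaleDensity_two_pow_le (r j : ℕ) : scaleDensity r (2 ^ j) ≤ (1 / 2) ^ j := by
  refine (scaleDensity_le r (Nat.two_pow_pos j)).trans (le_of_eq ?_)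
  push_cast
  rw [one_div_pow]

theorem summable_scaleDensity_two_pow (r : ℕ) : Summable fun j => scaleDensity r (2 ^ j) :=
  summable_geometric_two.of_nonneg_of_le (fun _ => scaleDensity_nonneg r _)
    (scaleDensity_two_pow_le r)

theorem abs_fInFork_sub_le_sum (r n J : ℕ) :
    |(fInFork r n : ℝ) - forkDensity r * n| ≤ 3 * (n / 2 ^ J) +
      ∑ j ∈ range J, |(topFree r (2 * 2 ^ j) n : ℝ) - topFree r (2 ^ j) n -
        scaleDensity r (2 ^ j) * n| := by
  have hs := (summable_scaleDensity_two_pow r).sum_add_tsum_nat_add J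
  set T := ∑' j, scaleDensity r (2 ^ (j + J)) with hT
  have hT0 : 0 ≤ T := tsum_nonneg fun _ => scaleDensity_nonneg r _
  have hT1 : T ≤ 2 / 2 ^ J := by
    calc T ≤ ∑' j : ℕ, (1 / 2 : ℝ) ^ j * (1 / 2) ^ J := by
          refine Summable.tsum_le_tsum (fun j => ?_)
            ((summable_nat_add_iff J).2 (summable_scaleDensity_two_pow r))
            (summable_geometric_two.mul_right _)
          rw [← pow_add]
          exact scaleDensity_two_pow_le r _
      _ = 2 / 2 ^ J := by
          rw [tsum_mul_right, tsum_geometric_two, one_div_pow, mul_one_div]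
  have htel : (topFree r (2 ^ J) n : ℝ) =
      ∑ j ∈ range J, ((topFree r (2 * 2 ^ j) n : ℝ) - topFree r (2 ^ j) n) := by
    have h := sum_range_sub (fun j => (topFree r (2 ^ j) n : ℝ)) J
    simp only [pow_zero, topFree_one, Nat.cast_zero, sub_zero] at h
    rw [← h]
    exact sum_congr rfl fun j _ => by rw [pow_succ']
  have h1 : (topFree r (2 ^ J) n : ℝ) ≤ fInFork r n := by
    exact_mod_cast topFree_le_fInFork r n _
  have h2 : (fInFork r n : ℝ) ≤ topFree r (2 ^ J) n + n / 2 ^ J := by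
    have h : (fInFork r n : ℝ) ≤ topFree r (2 ^ J) n + (n / 2 ^ J : ℕ) := by
      exact_mod_cast fInFork_le_topFree_add r n (Nat.two_pow_pos J)
    have h' := Nat.cast_div_le (α := ℝ) (m := n) (n := 2 ^ J)
    push_cast at h'
    linarith
  have h3 : (0 : ℝ) ≤ n * T ∧ (n : ℝ) * T ≤ 2 * (n / 2 ^ J) := by
    refine ⟨by positivity, ?_⟩
    calc (n : ℝ) * T ≤ n * (2 / 2 ^ J) := by gcongr
      _ = 2 * (n / 2 ^ J) := by ring
  have h4 : (fInFork r n : ℝ) - forkDensity r * n =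
      ((fInFork r n : ℝ) - topFree r (2 ^ J) n - n * T) +
        ∑ j ∈ range J, ((topFree r (2 * 2 ^ j) n : ℝ) - topFree r (2 ^ j) n -
          scaleDensity r (2 ^ j) * n) := by
    rw [sum_sub_distrib, ← htel, ← sum_mul, forkDensity, ← hs]
    ring
  rw [h4]
  refine (abs_add_le _ _).trans (add_le_add ?_ (abs_sum_le_sum_abs _ _))
  rw [abs_le]
  constructor <;> linarith

theorem abs_topFree_two_pow_sub_le (r : ℕ) {n j J : ℕ} (hn : 0 < n) (hj : j < J)
    {ε : ℝ} (hε0 : 0 < ε) (hε : ε < 1 / 2) (hn1 : 1 ≤ Real.log (Real.log n)) :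
    |(topFree r (2 * 2 ^ j) n : ℝ) - topFree r (2 ^ j) n - scaleDensity r (2 ^ j) * n| ≤
      10 * n * Real.exp (-((1 - 2 * ε) * √(Real.log n * Real.log (Real.log n))) +
        Real.log (Real.log n) +
        6 * (Real.log n ^ (1 / 2 - ε) * (5 + 4 * Real.log J))) := by
  have hn' : (0 : ℝ) < n := by exact_mod_cast hn
  set L := Real.log n with hL
  set l := Real.log L with hl
  have hL0 : 0 < L := by
    by_contra h
    have h1 : 0 ≤ L := Real.log_natCast_nonneg n
    rw [le_antisymm (not_lt.1 h) h1, Real.log_zero] at hl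
    linarith
  set Λ := √(L * l) with hΛ
  have hΛ2 : Λ ^ 2 = L * l := Real.sq_sqrt (by positivity)
  have hlog2 : 0 < Real.log 2 := Real.log_pos (by norm_num)
  set y := (j + 1) * Real.log 2 + l with hy
  have hy0 : 0 < y := by positivity
  have hyl : l ≤ y := by
    have : 0 ≤ (j + 1) * Real.log 2 := by positivity
    linarith
  set σ := (1 / 2 - ε) * l / y with hσ
  have hσ0 : 0 ≤ σ := div_nonneg (mul_nonneg (by linarith) (by linarith)) hy0.le
  have hσ1 : σ ≤ 1 / 2 := by
    rw [hσ, div_le_iff₀ hy0]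
    nlinarith
  refine (abs_topFree_sub_le r (Nat.two_pow_pos j) hn hσ0 hσ1).trans ?_
  have hK : ((2 * 2 ^ j : ℕ) : ℝ) ^ σ ≤ L ^ (1 / 2 - ε) := by
    rw [← pow_succ', Real.rpow_def_of_pos (by positivity), Real.rpow_def_of_pos hL0]
    refine Real.exp_le_exp.2 ?_
    push_cast
    rw [Real.log_pow, ← hl, hσ, ← mul_div_assoc, div_le_iff₀ hy0]
    push_cast
    have : (j + 1) * Real.log 2 ≤ y := by linarith
    have h0 : 0 ≤ (1 / 2 - ε) * l := mul_nonneg (by linarith) (by linarith)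
    nlinarith
  have hP : primeRecipSum (2 * 2 ^ j) ≤ 4 * (1 + Real.log J) := by
    rw [← pow_succ']
    refine (primeRecipSum_two_pow_le j).trans ?_
    gcongr 4 * (1 + ?_)
    rcases Nat.eq_zero_or_pos j with rfl | hj0
    · rw [Nat.cast_zero, Real.log_zero]
      exact Real.log_natCast_nonneg J
    · exact Real.log_le_log (by exact_mod_cast hj0) (by exact_mod_cast hj.le)
  have hmain : (1 - 2 * ε) * Λ ≤ y + σ * L / 2 := by
    rw [hσ, show (1 / 2 - ε) * l / y * L / 2 = ((1 - 2 * ε) / 4 * Λ ^ 2) / y by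
      rw [hΛ2]; ring, ← sub_le_iff_le_add', le_div_iff₀ hy0]
    have h0 : 0 ≤ 2 * ε * (1 - 2 * ε) * Λ ^ 2 :=
      mul_nonneg (mul_nonneg (by linarith) (by linarith)) (sq_nonneg _)
    nlinarith [sq_nonneg (y - (1 - 2 * ε) * Λ / 2)]
  have hP0 := primeRecipSum_nonneg (2 * 2 ^ j)
  have hexp : 6 * (((2 * 2 ^ j : ℕ) : ℝ) ^ σ * (1 + primeRecipSum (2 * 2 ^ j))) ≤
      6 * (L ^ (1 / 2 - ε) * (5 + 4 * Real.log J)) := by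
    have h0 : 1 + primeRecipSum (2 * 2 ^ j) ≤ 5 + 4 * Real.log J := by linarith
    gcongr
  have hk : (n : ℝ) / (2 ^ j : ℕ) = n * Real.exp (-(j * Real.log 2)) := by
    rw [← Real.log_pow, Real.exp_neg, Real.exp_log (by positivity)]
    push_cast
    rfl
  calc 5 * ((n : ℝ) / (2 ^ j : ℕ)) * (n : ℝ) ^ (-(σ / 2)) *
        Real.exp (6 * (((2 * 2 ^ j : ℕ) : ℝ) ^ σ * (1 + primeRecipSum (2 * 2 ^ j))))
      ≤ 5 * ((n : ℝ) / (2 ^ j : ℕ)) * (n : ℝ) ^ (-(σ / 2)) *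
        Real.exp (6 * (L ^ (1 / 2 - ε) * (5 + 4 * Real.log J))) := by gcongr
    _ = 10 * n * Real.exp (-(y + σ * L / 2) + l +
        6 * (L ^ (1 / 2 - ε) * (5 + 4 * Real.log J))) := by
        rw [hk, Real.rpow_def_of_pos hn', ← hL, hy]
        rw [show -((j + 1) * Real.log 2 + l + σ * L / 2) + l +
          6 * (L ^ (1 / 2 - ε) * (5 + 4 * Real.log J)) = -Real.log 2 + (-(j * Real.log 2) +
            (L * -(σ / 2) + 6 * (L ^ (1 / 2 - ε) * (5 + 4 * Real.log J)))) by ring,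
          Real.exp_add, Real.exp_add _ (_ + _), Real.exp_add, Real.exp_neg (Real.log 2),
          Real.exp_log (by norm_num)]
        ring
    _ ≤ _ := by gcongr

theorem abs_fInFork_sub_le (r : ℕ) {n : ℕ} (hn : 0 < n) {ε : ℝ} (hε0 : 0 < ε) (hε : ε < 1 / 2)
    (hn1 : 1 ≤ Real.log (Real.log n))
    (hn2 : 104 * Real.log (Real.log n) ≤ ε * Real.log n ^ ε) :
    |(fInFork r n : ℝ) - forkDensity r * n| ≤
      33 * n * Real.exp (-(1 - 3 * ε) * √(Real.log n * Real.log (Real.log n))) := by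
  have hn' : (0 : ℝ) < n := by exact_mod_cast hn
  set L := Real.log n with hL
  set l := Real.log L with hl
  have hL0 : 0 < L := by
    by_contra h
    have h1 : 0 ≤ L := Real.log_natCast_nonneg n
    rw [le_antisymm (not_lt.1 h) h1, Real.log_zero] at hl
    linarith
  have hLl : L = Real.exp l := (Real.exp_log hL0).symm
  have hlL : l ≤ L := by linarith [Real.add_one_le_exp l]
  have hL1 : 1 ≤ L := by linarith
  set Λ := √(L * l) with hΛ
  have hΛ0 : 0 ≤ Λ := Real.sqrt_nonneg _
  have hΛL : Λ ≤ L := by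
    rw [hΛ, Real.sqrt_le_left hL0.le, sq]
    gcongr
  have hLΛ : L ^ (1 / 2 : ℝ) ≤ Λ := by
    rw [← Real.sqrt_eq_rpow]
    exact Real.sqrt_le_sqrt (le_mul_of_one_le_right hL0.le hn1)
  have hlog2 : 1 / 2 < Real.log 2 := by linarith [Real.log_two_gt_d9]
  set J := ⌈Λ / Real.log 2⌉₊ with hJ
  have hJ1 : (J : ℝ) ≤ 3 * L := by
    have h1 := (Nat.ceil_lt_add_one (show 0 ≤ Λ / Real.log 2 by positivity)).le
    have h2 : Λ / Real.log 2 ≤ 2 * Λ := by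
      rw [div_le_iff₀ (by linarith)]
      nlinarith
    linarith
  have hJ2 : Λ ≤ J * Real.log 2 := by
    rw [← div_le_iff₀ (by linarith)]
    exact Nat.le_ceil _
  have hlogJ : Real.log J ≤ 2 + l := by
    have h3 : Real.log 3 ≤ 2 := by
      linarith [Real.log_le_sub_one_of_pos (show (0 : ℝ) < 3 by norm_num)]
    rcases Nat.eq_zero_or_pos J with h0 | h0
    · rw [h0, Nat.cast_zero, Real.log_zero]
      linarith
    · calc Real.log J ≤ Real.log (3 * L) := Real.log_le_log (by exact_mod_cast h0) hJ1
        _ = Real.log 3 + l := Real.log_mul (by norm_num) hL0.ne'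
        _ ≤ 2 + l := by linarith
  have hJexp : (n : ℝ) / 2 ^ J ≤ n * Real.exp (-Λ) := by
    rw [Real.exp_neg, ← div_eq_mul_inv]
    gcongr
    rw [← Real.exp_log (show (0 : ℝ) < 2 ^ J by positivity), Real.log_pow]
    exact Real.exp_le_exp.2 hJ2
  have hsmall : 2 * l + 6 * (L ^ (1 / 2 - ε) * (5 + 4 * Real.log J)) ≤ ε * Λ := by
    have hp1 : 1 ≤ L ^ (1 / 2 - ε) := Real.one_le_rpow hL1 (by linarith)
    calc 2 * l + 6 * (L ^ (1 / 2 - ε) * (5 + 4 * Real.log J))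
        ≤ L ^ (1 / 2 - ε) * (2 * l) + 6 * (L ^ (1 / 2 - ε) * (5 + 4 * (2 + l))) := by
          have := le_mul_of_one_le_left (show 0 ≤ 2 * l by linarith) hp1
          gcongr
      _ = L ^ (1 / 2 - ε) * (78 + 26 * l) := by ring
      _ ≤ L ^ (1 / 2 - ε) * (ε * L ^ ε) := by
          gcongr
          linarith
      _ = ε * L ^ (1 / 2 : ℝ) := by
          rw [mul_left_comm, ← Real.rpow_add hL0, sub_add_cancel]
      _ ≤ ε * Λ := by gcongr
  calc |(fInFork r n : ℝ) - forkDensity r * n|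
      ≤ 3 * (n / 2 ^ J) + ∑ j ∈ range J, 10 * n * Real.exp (-((1 - 2 * ε) * Λ) + l +
          6 * (L ^ (1 / 2 - ε) * (5 + 4 * Real.log J))) :=
        (abs_fInFork_sub_le_sum r n J).trans (add_le_add_right (sum_le_sum fun j hj =>
          abs_topFree_two_pow_sub_le r hn (mem_range.1 hj) hε0 hε hn1) _)
    _ ≤ 3 * (n * Real.exp (-Λ)) + 3 * L * (10 * n * Real.exp (-((1 - 2 * ε) * Λ) + l +
          6 * (L ^ (1 / 2 - ε) * (5 + 4 * Real.log J)))) := by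
        rw [sum_const, card_range, nsmul_eq_mul]
        gcongr
    _ = 3 * (n * Real.exp (-Λ)) + 30 * (n * Real.exp (-((1 - 2 * ε) * Λ) + (2 * l +
          6 * (L ^ (1 / 2 - ε) * (5 + 4 * Real.log J))))) := by
        rw [show -((1 - 2 * ε) * Λ) + (2 * l + 6 * (L ^ (1 / 2 - ε) * (5 + 4 * Real.log J))) =
          l + (-((1 - 2 * ε) * Λ) + l + 6 * (L ^ (1 / 2 - ε) * (5 + 4 * Real.log J))) by ring,
          Real.exp_add l, ← hLl]
        ring
    _ ≤ 3 * (n * Real.exp (-(1 - 3 * ε) * Λ)) + 30 * (n * Real.exp (-(1 - 3 * ε) * Λ)) := by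
        gcongr
        · nlinarith
        · linarith
    _ = 33 * n * Real.exp (-(1 - 3 * ε) * Λ) := by ring

/-- For every `r ≥ 2` there is a real constant `c*_r` with
`f*_r(n) = c*_r·n + O_ε(n · exp(−(1−ε)√(log n · log log n)))`. -/
theorem rInFork_density (r : ℕ) (hr : 2 ≤ r) :
    ∃ c : ℝ, ∀ ε : ℝ, 0 < ε → ∃ K : ℝ, ∀ n : ℕ, 3 ≤ n →
      |(fInFork r n : ℝ) - c * n| ≤
        K * n * Real.exp (-(1 - ε) * Real.sqrt (Real.log n * Real.log (Real.log n))) := by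
  refine ⟨forkDensity r, fun ε hε => ?_⟩
  obtain ⟨δ, hδ0, hδ, hδε⟩ : ∃ δ : ℝ, 0 < δ ∧ δ < 1 / 2 ∧ 3 * δ ≤ ε :=
    ⟨min (ε / 3) (1 / 4), by positivity, (min_le_right _ _).trans_lt (by norm_num),
      by linarith [min_le_left (ε / 3) (1 / 4)]⟩
  have hlog : Filter.Tendsto (fun n : ℕ => Real.log n) Filter.atTop Filter.atTop :=
    Real.tendsto_log_atTop.comp tendsto_natCast_atTop_atTop
  have h1 : ∀ᶠ n : ℕ in Filter.atTop, 1 ≤ Real.log (Real.log n) :=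
    (Real.tendsto_log_atTop.comp hlog).eventually_ge_atTop 1
  have h2 : ∀ᶠ n : ℕ in Filter.atTop,
      104 * Real.log (Real.log n) ≤ δ * Real.log n ^ δ := by
    have h := hlog.eventually ((isLittleO_log_rpow_atTop hδ0).bound
      (show 0 < δ / 104 by positivity))
    filter_upwards [h, hlog.eventually_ge_atTop 0] with n hn hn0
    rw [Real.norm_eq_abs, Real.norm_of_nonneg (Real.rpow_nonneg hn0 _)] at hn
    linarith [le_abs_self (Real.log (Real.log n))]
  obtain ⟨N, hN⟩ := Filter.eventually_atTop.1 (h1.and h2)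
  let g : ℕ → ℝ := fun n =>
    n * Real.exp (-(1 - ε) * Real.sqrt (Real.log n * Real.log (Real.log n)))
  let q : ℕ → ℝ := fun n => |(fInFork r n : ℝ) - forkDensity r * n| / g n
  have hg0 : ∀ n, 0 ≤ g n := fun n => by positivity
  have hq0 : ∀ n, 0 ≤ q n := fun n => div_nonneg (abs_nonneg _) (hg0 n)
  refine ⟨33 + ∑ n ∈ range N, q n, fun n hn => ?_⟩
  have hn' : (0 : ℝ) < n := by exact_mod_cast (by omega : 0 < n)
  rw [mul_assoc]
  change _ ≤ _ * g n
  rcases lt_or_ge n N with hnN | hnN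
  · have hg : 0 < g n := by positivity
    rw [← div_le_iff₀ hg]
    have := single_le_sum (fun i _ => hq0 i) (mem_range.2 hnN)
    change q n ≤ _
    linarith
  · obtain ⟨h3, h4⟩ := hN n hnN
    calc |(fInFork r n : ℝ) - forkDensity r * n|
        ≤ 33 * n * Real.exp (-(1 - 3 * δ) * √(Real.log n * Real.log (Real.log n))) :=
          abs_fInFork_sub_le r (by omega) hδ0 hδ h3 h4
      _ ≤ 33 * n * Real.exp (-(1 - ε) * √(Real.log n * Real.log (Real.log n))) := by
          gcongr
      _ = 33 * g n := mul_assoc _ _ _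
      _ ≤ (33 + ∑ n ∈ range N, q n) * g n := by
          have := sum_nonneg fun i (_ : i ∈ range N) => hq0 i
          exact mul_le_mul_of_nonneg_right (by linarith) (hg0 n)
end

section
/- Let P be a family of finite subsets of the positive integers with ∅ ∈ P that decomposes over coprime components: whenever a finite set T is a disjoint union T = T₁ ⊔ T₂ with no element of T₁ dividing or being divided by any element of T₂, a subset B ⊆ T belongs to P if and only if B ∩ T₁ ∈ P and B ∩ T₂ ∈ P. For 1 ≤ a ≤ n, let C(a,n) denote the connected component of a in the divisor graph on {a, ..., n} (the graph with vertex set {a, ..., n} and an edge between distinct u, v whenever u ∣ v or v ∣ u), and let F_P(a,n) be the maximum cardinality of a subset of {a, ..., n} in P. Then F_P(a,n) − F_P(a+1,n) = Φ_P(C(a,n)) − Φ_P(C(a,n) \ {a}), where Φ_P(T) is the maximum cardinality of a subset of T in P. -/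
open Finset
open scoped Classical

/-- `Φ_P(T)`: the maximum cardinality of a subset of `T` belonging to `P`. -/
noncomputable def PhiP (P : Finset ℕ → Prop) (T : Finset ℕ) : ℕ :=
  (T.powerset.filter P).sup Finset.card

/-- `F_P(a, n) = Φ_P({a, …, n})`. -/
noncomputable def FP (P : Finset ℕ → Prop) (a n : ℕ) : ℕ := PhiP P (Finset.Icc a n)

/-- One step in the divisor graph on the finite set `S`: `u` and `v` are distinct members
of `S` and one divides the other. -/
def DivStep (S : Finset ℕ) (u v : ℕ) : Prop :=
  u ∈ S ∧ v ∈ S ∧ u ≠ v ∧ (u ∣ v ∨ v ∣ u)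

/-- `C(a, n)`: the connected component of `a` in the divisor graph on `{a, …, n}`. -/
noncomputable def component (a n : ℕ) : Finset ℕ :=
  (Finset.Icc a n).filter fun b => Relation.ReflTransGen (DivStep (Finset.Icc a n)) a b

theorem card_le_PhiP {P : Finset ℕ → Prop} {T B : Finset ℕ} (hB : B ⊆ T) (hP : P B) :
    B.card ≤ PhiP P T :=
  Finset.le_sup (f := Finset.card) (by simp [hB, hP])

theorem exists_card_eq_PhiP {P : Finset ℕ → Prop} (hempty : P ∅) (T : Finset ℕ) :
    ∃ B ⊆ T, P B ∧ B.card = PhiP P T := by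
  have hne : (T.powerset.filter P).Nonempty := ⟨∅, by simp [hempty]⟩
  obtain ⟨B, hB, h⟩ := Finset.exists_mem_eq_sup _ hne Finset.card
  simp only [Finset.mem_filter, Finset.mem_powerset] at hB
  exact ⟨B, hB.1, hB.2, h.symm⟩

/-- `Φ_P` is additive over a disjoint union along which `P` decomposes. -/
theorem PhiP_union {P : Finset ℕ → Prop} (hempty : P ∅) {T₁ T₂ : Finset ℕ}
    (hd : Disjoint T₁ T₂) (hP : ∀ B ⊆ T₁ ∪ T₂, (P B ↔ P (B ∩ T₁) ∧ P (B ∩ T₂))) :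
    PhiP P (T₁ ∪ T₂) = PhiP P T₁ + PhiP P T₂ := by
  apply le_antisymm
  · obtain ⟨B, hB, hPB, hc⟩ := exists_card_eq_PhiP hempty (T₁ ∪ T₂)
    obtain ⟨h₁, h₂⟩ := (hP B hB).1 hPB
    have hsplit : B = B ∩ T₁ ∪ B ∩ T₂ := by
      rw [← Finset.inter_union_distrib_left, Finset.inter_eq_left.2 hB]
    calc PhiP P (T₁ ∪ T₂) = (B ∩ T₁ ∪ B ∩ T₂).card := by rw [← hsplit, hc]
      _ ≤ (B ∩ T₁).card + (B ∩ T₂).card := Finset.card_union_le _ _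
      _ ≤ _ := add_le_add (card_le_PhiP Finset.inter_subset_right h₁)
        (card_le_PhiP Finset.inter_subset_right h₂)
  · obtain ⟨B₁, hB₁, hP₁, hc₁⟩ := exists_card_eq_PhiP hempty T₁
    obtain ⟨B₂, hB₂, hP₂, hc₂⟩ := exists_card_eq_PhiP hempty T₂
    have e₁ : (B₁ ∪ B₂) ∩ T₁ = B₁ := by
      rw [Finset.union_inter_distrib_right, Finset.inter_eq_left.2 hB₁,
        Finset.disjoint_iff_inter_eq_empty.1 (hd.symm.mono_left hB₂), Finset.union_empty]
    have e₂ : (B₁ ∪ B₂) ∩ T₂ = B₂ := by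
      rw [Finset.union_inter_distrib_right, Finset.inter_eq_left.2 hB₂,
        Finset.disjoint_iff_inter_eq_empty.1 (hd.mono_left hB₁), Finset.empty_union]
    have hsub := Finset.union_subset_union hB₁ hB₂
    rw [← hc₁, ← hc₂, ← Finset.card_union_of_disjoint (hd.mono hB₁ hB₂)]
    exact card_le_PhiP hsub ((hP _ hsub).2 (by rw [e₁, e₂]; exact ⟨hP₁, hP₂⟩))

theorem component_subset (a n : ℕ) : component a n ⊆ Finset.Icc a n :=
  Finset.filter_subset _ _

theorem self_mem_component {a n : ℕ} (han : a ≤ n) : a ∈ component a n :=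
  Finset.mem_filter.2 ⟨Finset.left_mem_Icc.2 han, .refl⟩

theorem not_dvd_of_mem_component {a n u v : ℕ} (hu : u ∈ component a n)
    (hv : v ∈ Finset.Icc a n \ component a n) : ¬u ∣ v ∧ ¬v ∣ u := by
  obtain ⟨hvI, hvC⟩ := Finset.mem_sdiff.1 hv
  have hne : u ≠ v := fun h => hvC (h ▸ hu)
  rw [← not_or]
  intro h
  obtain ⟨huI, hr⟩ := Finset.mem_filter.1 hu
  exact hvC (Finset.mem_filter.2 ⟨hvI, hr.tail ⟨huI, hvI, hne, h⟩⟩)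

/-- If `P` decomposes over coprime components, then the increment
`F_P(a, n) − F_P(a+1, n)` equals `Φ_P(C(a, n)) − Φ_P(C(a, n) \ {a})`. -/
theorem increment_local (P : Finset ℕ → Prop)
    (hpos : ∀ B : Finset ℕ, P B → ∀ b ∈ B, 0 < b)
    (hempty : P ∅)
    (hdecomp : ∀ T₁ T₂ : Finset ℕ, (∀ a ∈ T₁, 0 < a) → (∀ b ∈ T₂, 0 < b) →
        Disjoint T₁ T₂ → (∀ a ∈ T₁, ∀ b ∈ T₂, ¬a ∣ b ∧ ¬b ∣ a) →
        ∀ B ⊆ T₁ ∪ T₂, (P B ↔ P (B ∩ T₁) ∧ P (B ∩ T₂)))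
    (a n : ℕ) (ha : 1 ≤ a) (han : a ≤ n) :
    (FP P a n : ℤ) - (FP P (a + 1) n : ℤ) =
      (PhiP P (component a n) : ℤ) - (PhiP P ((component a n).erase a) : ℤ) := by
  have hIpos : ∀ x ∈ Finset.Icc a n, 0 < x := fun x hx => ha.trans (Finset.mem_Icc.1 hx).1
  have hadd : ∀ S ⊆ component a n, PhiP P (S ∪ (Finset.Icc a n \ component a n)) =
      PhiP P S + PhiP P (Finset.Icc a n \ component a n) := by
    intro S hS
    have hd : Disjoint S (Finset.Icc a n \ component a n) :=
      Finset.disjoint_sdiff.mono_left hS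
    exact PhiP_union hempty hd (hdecomp _ _ (fun x hx => hIpos x (component_subset a n (hS hx)))
      (fun x hx => hIpos x (Finset.mem_sdiff.1 hx).1) hd
      fun u hu v hv => not_dvd_of_mem_component (hS hu) hv)
  have hfull : component a n ∪ (Finset.Icc a n \ component a n) = Finset.Icc a n :=
    Finset.union_sdiff_of_subset (component_subset a n)
  have herase : (component a n).erase a ∪ (Finset.Icc a n \ component a n) =
      Finset.Icc (a + 1) n := by
    have haC := self_mem_component han
    have hIcc : Finset.Icc (a + 1) n = (Finset.Icc a n).erase a := by
      ext x
      simp only [Finset.mem_Icc, Finset.mem_erase]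
      omega
    rw [hIcc, ← hfull, Finset.erase_union_distrib,
      Finset.erase_eq_of_notMem (s := Finset.Icc a n \ _) (by simp [haC]), hfull]
  have h₁ := hadd _ subset_rfl
  have h₂ := hadd _ (Finset.erase_subset a _)
  rw [hfull] at h₁
  rw [herase] at h₂
  simp only [FP, h₁, h₂]
  push_cast
  ring
end
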